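/- arXiv:2311.03013 — 2 statements merged into one kernel-verified Lean document; each statement's English description precedes it below -/
import Mathlib

section
/- Let S ∈ L¹_loc[0,∞) be log-linearly slowly decreasing, with Laplace transform 𝓛{S;s} = ∫₀^∞ e^{−sx} S(x) dx convergent for every complex s with Re s > 1, and set U(s) = Re 𝓛{S;s}. Assume U has L¹_loc-boundary behavior on 1 + i(ℝ∖{0}). Assume further there exist λ > 0, g ∈ L¹(−λ,λ), a non-decreasing function η : [0,∞) → [1,∞) with ∫₁^∞ (log η(x))/x² dx < ∞, and C > 0 such that U(σ+it) ≥ g(t) for a.e. t ∈ (−λ,λ) and all σ ∈ (1,2], and |U(σ+it)| ≤ C·exp(η(1/(σ−1))) for all t ∈ (−λ,λ) and σ ∈ (1,2]. Then the limit a = lim_{σ→1⁺} (σ−1) U(σ) exists and S(x) ∼ a e^x as x → ∞, i.e. lim_{x→∞} e^{−x} S(x) = a. -/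
open MeasureTheory Filter Set
/-- The Laplace transform `𝓛{S;s} = ∫₀^∞ e^{-sx} S(x) dx`. -/
noncomputable def laplaceT (S : ℝ → ℝ) (s : ℂ) : ℂ :=
  ∫ x in Ioi (0 : ℝ), Complex.exp (-s * x) * (S x : ℂ)

/-- `S` is log-linearly slowly decreasing. -/
def LogLinSlowlyDecreasing (S : ℝ → ℝ) : Prop :=
  ∀ ε : ℝ, 0 < ε → ∃ h : ℝ, 0 < h ∧ ∃ x₀ : ℝ, 0 < x₀ ∧ ∀ x y : ℝ,
    x₀ ≤ x → x ≤ y → y ≤ x + h → (S y - S x) / Real.exp x ≥ -ε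

/-- `U` (defined on `Re s > 1`) has `L¹_loc`-boundary behavior on `1 + i(ℝ∖{0})`. -/
def L1locBoundaryBehavior (U : ℂ → ℝ) : Prop :=
  ∃ f : ℝ → ℝ, ∀ a b : ℝ, a ≤ b → (0 : ℝ) ∉ Icc a b →
    IntegrableOn f (Icc a b) ∧
    Tendsto (fun σ : ℝ => ∫ t in a..b, |U (σ + t * Complex.I) - f t|)
      (nhdsWithin 1 (Ioi 1)) (nhds 0)

/-- Fejer kernel. -/
noncomputable def Kf (x : ℝ) : ℝ := 2 * ∫ t in (0:ℝ)..1, (1 - t) * Real.cos (t * x)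

lemma Kf_eq (x : ℝ) (hx : x ≠ 0) : Kf x = 2 * (1 - Real.cos x) / x ^ 2 := by
  have h : ∫ t in (0:ℝ)..1, (1 - t) * Real.cos (t * x) =
      ((1 - 1) * Real.sin (1 * x) / x - Real.cos (1 * x) / x ^ 2)
      - ((1 - 0) * Real.sin (0 * x) / x - Real.cos (0 * x) / x ^ 2) := by
    apply intervalIntegral.integral_eq_sub_of_hasDerivAt
      (f := fun t => (1 - t) * Real.sin (t * x) / x - Real.cos (t * x) / x ^ 2)
    · intro t _
      have h1 : HasDerivAt (fun t : ℝ => t * x) x t := by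
        simpa using (hasDerivAt_id t).mul_const x
      have h2 : HasDerivAt (fun t : ℝ => 1 - t) (-1) t := by
        simpa using (hasDerivAt_id t).const_sub 1
      have h3 := ((h2.mul h1.sin).div_const x).sub (h1.cos.div_const (x ^ 2))
      refine h3.congr_deriv ?_
      field_simp
      ring
    · apply Continuous.intervalIntegrable
      fun_prop
  rw [Kf, h]
  simp
  field_simp
  ring

lemma Kf_zero : Kf 0 = 1 := by
  have h : ∫ t in (0:ℝ)..1, (1 - t) * Real.cos (t * 0) = 1/2 := by
    simp
    rw [intervalIntegral.integral_sub (by simp) (by simp)]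
    simp
    norm_num
  rw [Kf, h]; norm_num

lemma Kf_nonneg (x : ℝ) : 0 ≤ Kf x := by
  by_cases hx : x = 0
  · rw [hx, Kf_zero]; norm_num
  · rw [Kf_eq x hx]
    have := Real.cos_le_one x
    have : 0 ≤ 1 - Real.cos x := by linarith
    positivity

lemma Kf_le (x : ℝ) : Kf x ≤ 8 * (1 + x ^ 2)⁻¹ := by
  by_cases hx : x = 0
  · rw [hx, Kf_zero]; norm_num
  · rw [Kf_eq x hx]
    have h1 := Real.neg_one_le_cos x
    have h2 := Real.one_sub_sq_div_two_le_cos (x := x)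
    have hx2 : 0 < x ^ 2 := by positivity
    rw [← div_eq_mul_inv, div_le_div_iff₀ hx2 (by positivity)]
    by_cases h : x ^ 2 ≤ 1
    · nlinarith
    · nlinarith

lemma Kf_le8 (x : ℝ) : Kf x ≤ 8 := by
  refine (Kf_le x).trans ?_
  have : (1 + x ^ 2)⁻¹ ≤ 1 := inv_le_one_of_one_le₀ (by nlinarith [sq_nonneg x])
  linarith

lemma Kf_cont : Continuous Kf := by
  unfold Kf
  apply Continuous.mul continuous_const
  apply intervalIntegral.continuous_parametric_intervalIntegral_of_continuous'
  fun_prop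

lemma Kf_int : Integrable Kf := by
  refine (integrable_inv_one_add_sq.const_mul 8).mono' Kf_cont.aestronglyMeasurable ?_
  refine Eventually.of_forall fun x => ?_
  rw [Real.norm_of_nonneg (Kf_nonneg x)]
  exact Kf_le x

lemma Kf_pos : 0 < ∫ x, Kf x := by
  rw [integral_pos_iff_support_of_nonneg Kf_nonneg Kf_int]
  apply IsOpen.measure_pos _ (Kf_cont.isOpen_support)
  exact ⟨0, by simp [Kf_zero]⟩

lemma Kf_scale (L : ℝ) (hL : 0 < L) (x : ℝ) :
    ∫ t in (0:ℝ)..L, (1 - t / L) * Real.cos (t * x) = L / 2 * Kf (L * x) := by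
  have h := intervalIntegral.integral_comp_div (a := 0) (b := L)
    (fun t => (1 - t) * Real.cos (t * (L * x))) hL.ne'
  have h2 : ∀ t : ℝ, (1 - t / L) * Real.cos (t / L * (L * x)) = (1 - t / L) * Real.cos (t * x) := by
    intro t
    congr 2
    field_simp
  simp only [h2] at h
  rw [h, Kf, zero_div, div_self hL.ne', smul_eq_mul]
  ring

lemma Kf_cc (L : ℝ) (hL : 0 < L) (x y : ℝ) :
    ∫ t in (0:ℝ)..L, (1 - t / L) * Real.cos (t * y) * Real.cos (t * x)
      = L / 4 * (Kf (L * (x - y)) + Kf (L * (x + y))) := by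
  have h1 := Kf_scale L hL (x - y)
  have h2 := Kf_scale L hL (x + y)
  have h3 : ∀ t : ℝ, (1 - t / L) * Real.cos (t * y) * Real.cos (t * x) =
      (1/2) * ((1 - t / L) * Real.cos (t * (x - y)) + (1 - t / L) * Real.cos (t * (x + y))) := by
    intro t
    rw [mul_sub t x y, mul_add t x y, Real.cos_sub, Real.cos_add]
    ring
  simp only [h3]
  rw [intervalIntegral.integral_const_mul, intervalIntegral.integral_add, h1, h2]
  · ring
  · apply Continuous.intervalIntegrable; fun_prop
  · apply Continuous.intervalIntegrable; fun_prop

/-- Damped cosine transform. -/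
noncomputable def VV (D : ℝ → ℝ) (δ t : ℝ) : ℝ := ∫ x, Real.exp (-δ * x) * Real.cos (t * x) * D x

lemma cos_cos_int (T b x : ℝ) (hb : b * T = Real.pi / 2) (hb0 : 0 < b) (hx : b < x) :
    ∫ t in (0:ℝ)..T, Real.cos (b * t) * Real.cos (t * x) = - (Real.cos (T * x) * (b / (x ^ 2 - b ^ 2))) := by
  have e1 : x - b ≠ 0 := by linarith
  have e2 : x + b ≠ 0 := by linarith
  have e3 : x ^ 2 - b ^ 2 ≠ 0 := by
    have : x ^ 2 - b ^ 2 = (x - b) * (x + b) := by ring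
    rw [this]; exact mul_ne_zero e1 e2
  have h : ∫ t in (0:ℝ)..T, Real.cos (b * t) * Real.cos (t * x) =
      (1/2 * (Real.sin (T * (x - b)) / (x - b) + Real.sin (T * (x + b)) / (x + b)))
      - (1/2 * (Real.sin (0 * (x - b)) / (x - b) + Real.sin (0 * (x + b)) / (x + b))) := by
    apply intervalIntegral.integral_eq_sub_of_hasDerivAt
      (f := fun t => 1/2 * (Real.sin (t * (x - b)) / (x - b) + Real.sin (t * (x + b)) / (x + b)))
    · intro t _
      have h1 : ∀ c : ℝ, HasDerivAt (fun t : ℝ => t * c) c t := fun c => by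
        simpa using (hasDerivAt_id t).mul_const c
      have h3 := (((h1 (x - b)).sin.div_const (x - b)).add ((h1 (x + b)).sin.div_const (x + b))).const_mul (1/2)
      refine h3.congr_deriv ?_
      rw [mul_div_assoc, mul_div_assoc, div_self e1, div_self e2, mul_sub t x b, mul_add t x b, Real.cos_sub, Real.cos_add,
        mul_comm t b]
      ring
    · apply Continuous.intervalIntegrable
      fun_prop
  rw [h]
  have s1 : Real.sin (T * (x - b)) = - Real.cos (T * x) := by
    rw [mul_sub, mul_comm T b, hb, Real.sin_sub_pi_div_two]
  have s2 : Real.sin (T * (x + b)) = Real.cos (T * x) := by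
    rw [mul_add, mul_comm T b, hb, Real.sin_add_pi_div_two]
  rw [s1, s2]
  simp
  field_simp
  ring

lemma sinh_int (b x : ℝ) (hb0 : 0 < b) (hx : b < x) :
    IntegrableOn (fun u => Real.exp (-x * u) * Real.sinh (b * u)) (Ioi 0) ∧
    ∫ u in Ioi (0:ℝ), Real.exp (-x * u) * Real.sinh (b * u) = b / (x ^ 2 - b ^ 2) := by
  have e1 : x - b ≠ 0 := by linarith
  have e2 : x + b ≠ 0 := by linarith
  have e3 : x ^ 2 - b ^ 2 ≠ 0 := by
    have : x ^ 2 - b ^ 2 = (x - b) * (x + b) := by ring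
    rw [this]; exact mul_ne_zero e1 e2
  have h : (fun u => Real.exp (-x * u) * Real.sinh (b * u)) =
      fun u => 1/2 * (Real.exp ((b - x) * u) - Real.exp (-(x + b) * u)) := by
    funext u
    rw [Real.sinh_eq, show (b - x) * u = -x * u + b * u by ring, show -(x + b) * u = -x * u + -(b * u) by ring,
      Real.exp_add, Real.exp_add]
    ring
  have i1 : IntegrableOn (fun u => Real.exp ((b - x) * u)) (Ioi 0) :=
    integrableOn_exp_mul_Ioi (by linarith) 0
  have i2 : IntegrableOn (fun u => Real.exp (-(x + b) * u)) (Ioi 0) :=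
    integrableOn_exp_mul_Ioi (by linarith) 0
  rw [h]
  refine ⟨(i1.sub i2).const_mul _, ?_⟩
  rw [integral_const_mul, integral_sub i1 i2, integral_exp_mul_Ioi (by linarith), integral_exp_mul_Ioi (by linarith)]
  rw [show b - x = -(x-b) by ring, mul_zero, mul_zero, Real.exp_zero, neg_div_neg_eq, neg_div_neg_eq]
  field_simp
  ring

lemma VV_integrable (D : ℝ → ℝ) (hint : ∀ δ > 0, Integrable (fun x => Real.exp (-δ * x) * D x))
    (δ t : ℝ) (hδ : 0 < δ) : Integrable (fun x => Real.exp (-δ * x) * Real.cos (t * x) * D x) := by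
  have h := (hint δ hδ).bdd_mul (c := 1) (f := fun x => Real.cos (t * x))
    (by apply Continuous.aestronglyMeasurable; fun_prop)
    (Eventually.of_forall fun x => by simpa using Real.abs_cos_le_one (t * x))
  refine h.congr (Eventually.of_forall fun x => ?_)
  simp only []
  ring

lemma VV_cont (D : ℝ → ℝ) (hint : ∀ δ > 0, Integrable (fun x => Real.exp (-δ * x) * D x))
    (δ : ℝ) (hδ : 0 < δ) : Continuous (fun t => VV D δ t) := by
  unfold VV
  apply continuous_of_dominated (bound := fun x => ‖Real.exp (-δ * x) * D x‖)
  · intro t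
    exact (VV_integrable D hint δ t hδ).aestronglyMeasurable
  · intro t
    refine Eventually.of_forall fun x => ?_
    rw [norm_mul, norm_mul, norm_mul]
    have : ‖Real.cos (t * x)‖ ≤ 1 := by simpa using Real.abs_cos_le_one (t * x)
    have h2 := norm_nonneg (Real.exp (-δ * x))
    have h3 := norm_nonneg (D x)
    have : ‖Real.exp (-δ * x)‖ * ‖Real.cos (t * x)‖ ≤ ‖Real.exp (-δ * x)‖ := by nlinarith
    exact mul_le_mul_of_nonneg_right this h3
  · exact (hint δ hδ).norm
  · refine Eventually.of_forall fun x => ?_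
    fun_prop

lemma VV_fubini (D : ℝ → ℝ) (hint : ∀ δ > 0, Integrable (fun x => Real.exp (-δ * x) * D x))
    (δ : ℝ) (hδ : 0 < δ) (φ : ℝ → ℝ) (hφ : Continuous φ) (L : ℝ) (hL : 0 ≤ L) :
    ∫ t in (0:ℝ)..L, φ t * VV D δ t =
      ∫ x, Real.exp (-δ * x) * D x * ∫ t in (0:ℝ)..L, φ t * Real.cos (t * x) := by
  simp only [intervalIntegral.integral_of_le hL]
  have h1 : ∀ x, Real.exp (-δ * x) * D x * ∫ t in Ioc 0 L, φ t * Real.cos (t * x)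
     = ∫ t in Ioc 0 L, φ t * (Real.exp (-δ * x) * Real.cos (t * x) * D x) := by
    intro x
    rw [← integral_const_mul]
    congr 1
    funext t
    ring
  simp only [h1, VV, ← integral_const_mul]
  apply integral_integral_swap
  have hφi : IntegrableOn φ (Ioc 0 L) := (hφ.integrableOn_Icc).mono_set Ioc_subset_Icc_self
  have h2 := Integrable.mul_prod (hφi : Integrable φ (volume.restrict (Ioc 0 L))) (hint δ hδ)
  have h3 := h2.bdd_mul (c := 1) (f := fun z : ℝ × ℝ => Real.cos (z.1 * z.2))
    (by apply Continuous.aestronglyMeasurable; fun_prop)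
    (Eventually.of_forall fun z => by simpa using Real.abs_cos_le_one (z.1 * z.2))
  refine h3.congr (Eventually.of_forall fun z => ?_)
  simp only [Function.uncurry]
  ring

lemma VV_sinh (D : ℝ → ℝ) (X0 : ℝ) (hD0 : ∀ x < X0, D x = 0)
    (hint : ∀ δ > 0, Integrable (fun x => Real.exp (-δ * x) * D x))
    (δ : ℝ) (hδ : 0 < δ) (T b : ℝ) (hb0 : 0 < b) (hbX : b < X0) :
    Integrable (fun u => Real.sinh (b * u) * VV D (δ + u) T) (volume.restrict (Ioi 0)) ∧
    ∫ u in Ioi (0:ℝ), Real.sinh (b * u) * VV D (δ + u) T =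
      ∫ x, Real.exp (-δ * x) * D x * (Real.cos (T * x) * (b / (x ^ 2 - b ^ 2))) := by
  have key : Integrable (Function.uncurry fun u x =>
      Real.sinh (b * u) * (Real.exp (-(δ + u) * x) * Real.cos (T * x) * D x))
      ((volume.restrict (Ioi (0:ℝ))).prod volume) := by
    have h2 := Integrable.mul_prod (sinh_int b X0 hb0 hbX).1 (hint δ hδ)
    refine h2.mono ?_ ?_
    · have h3 : AEStronglyMeasurable (fun z : ℝ × ℝ => Real.exp (-δ * z.2) * D z.2)
        ((volume.restrict (Ioi (0:ℝ))).prod volume) :=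
        (hint δ hδ).aestronglyMeasurable.comp_snd
      have h4 : AEStronglyMeasurable (fun z : ℝ × ℝ => Real.sinh (b * z.1) * Real.exp (- z.1 * z.2) * Real.cos (T * z.2))
        ((volume.restrict (Ioi (0:ℝ))).prod volume) := by
        apply Continuous.aestronglyMeasurable; fun_prop
      refine (h4.mul h3).congr (Eventually.of_forall fun z => ?_)
      simp only [Function.uncurry, Pi.mul_apply]
      rw [show -(δ + z.1) * z.2 = -δ * z.2 + - z.1 * z.2 by ring, Real.exp_add]
      ring
    · have hpos : ∀ᵐ z ∂((volume.restrict (Ioi (0:ℝ))).prod (volume : Measure ℝ)), 0 < z.1 := by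
        have := ae_restrict_mem (μ := (volume : Measure ℝ)) (measurableSet_Ioi (a := (0:ℝ)))
        exact Measure.quasiMeasurePreserving_fst.ae this
      filter_upwards [hpos] with z hz
      simp only [Function.uncurry]
      by_cases hx : z.2 < X0
      · simp [hD0 _ hx]
      · push Not at hx
        rw [show -(δ + z.1) * z.2 = -δ * z.2 + - z.1 * z.2 by ring, Real.exp_add]
        simp only [norm_mul, Real.norm_eq_abs, Real.abs_exp]
        have c1 := Real.abs_cos_le_one (T * z.2)
        have c2 : Real.exp (-z.1 * z.2) ≤ Real.exp (-X0 * z.1) := Real.exp_le_exp.mpr (by nlinarith)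
        have c3 : Real.exp (-z.1 * z.2) * |Real.cos (T * z.2)| ≤ Real.exp (-X0 * z.1) * 1 :=
          mul_le_mul c2 c1 (abs_nonneg _) (Real.exp_pos _).le
        have c4 : 0 ≤ |Real.sinh (b * z.1)| * Real.exp (-δ * z.2) * |D z.2| := by positivity
        nlinarith [mul_le_mul_of_nonneg_left c3 c4]
  have e1 : ∀ u, Real.sinh (b * u) * VV D (δ + u) T =
      ∫ x, Real.sinh (b * u) * (Real.exp (-(δ + u) * x) * Real.cos (T * x) * D x) := by
    intro u
    rw [VV, ← integral_const_mul]
  constructor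
  · simp only [e1]
    exact key.integral_prod_left
  · simp only [e1]
    rw [integral_integral_swap key]
    congr 1
    funext x
    by_cases hx : x < X0
    · simp [hD0 _ hx]
    · push Not at hx
      rw [← (sinh_int b x hb0 (by linarith)).2, ← integral_const_mul, ← integral_const_mul]
      congr 1
      funext u
      rw [show -(δ + u) * x = -δ * x + - x * u by ring, Real.exp_add]
      ring

lemma VV_cos_bound (D : ℝ → ℝ) (X0 : ℝ) (hD0 : ∀ x < X0, D x = 0) (hDnn : ∀ x, 0 ≤ D x)
    (hint : ∀ δ > 0, Integrable (fun x => Real.exp (-δ * x) * D x))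
    (T b : ℝ) (hT : 0 < T) (hb0 : 0 < b) (hb : b * T = Real.pi / 2) (hbX : b < X0)
    (M1 : ℝ) (hM1 : ∀ δ ∈ Ioc (0:ℝ) 1, -M1 ≤ VV D δ T) :
    ∃ M, ∀ δ ∈ Ioc (0:ℝ) 1, ∫ t in (0:ℝ)..T, Real.cos (b * t) * VV D δ t ≤ M := by
  have hX0 : 0 < X0 := hb0.trans hbX
  set N := ∫ x, Real.exp (-1 * x) * D x with hN
  have hN0 : 0 ≤ N := integral_nonneg fun x => mul_nonneg (Real.exp_pos _).le (hDnn x)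
  set M2 := (|M1| + N) * Real.exp X0 with hM2
  have hlow : ∀ δ ∈ Ioc (0:ℝ) 1, ∀ u > 0, -(M2 * Real.exp (-X0 * u)) ≤ VV D (δ + u) T := by
    intro δ hδ u hu
    by_cases h : δ + u ≤ 1
    · refine le_trans ?_ (hM1 (δ + u) ⟨by linarith [hδ.1], h⟩)
      rw [neg_le_neg_iff, hM2, mul_assoc, ← Real.exp_add]
      have : 1 ≤ Real.exp (X0 + -X0 * u) := Real.one_le_exp (by nlinarith [hδ.1])
      nlinarith [le_abs_self M1, abs_nonneg M1]
    · push Not at h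
      have hpos : 0 < δ + u := by linarith
      have h1 : -VV D (δ + u) T ≤ ∫ x, Real.exp (-X0 * (u - 1)) * (Real.exp (-1 * x) * D x) := by
        rw [VV, ← integral_neg]
        apply integral_mono (VV_integrable D hint _ T hpos).neg ((hint 1 one_pos).const_mul _)
        intro x
        simp only [Pi.neg_apply]
        by_cases hx : x < X0
        · simp [hD0 _ hx]
        · push Not at hx
          have c1 := Real.neg_one_le_cos (T * x)
          have c2 : Real.exp (-(δ + u) * x) ≤ Real.exp (-X0 * (u - 1)) * Real.exp (-1 * x) := by
            rw [← Real.exp_add]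
            refine Real.exp_le_exp.mpr ?_
            nlinarith [hδ.1, mul_nonneg (sub_nonneg.mpr hx) (sub_nonneg.mpr h.le), mul_pos hδ.1 hX0]
          have c3 := hDnn x
          have c4 := Real.exp_pos (-(δ + u) * x)
          have c5 : -(Real.exp (-(δ + u) * x) * Real.cos (T * x)) ≤ Real.exp (-X0 * (u - 1)) * Real.exp (-1 * x) := by
            nlinarith
          nlinarith [mul_le_mul_of_nonneg_right c5 c3]
      rw [integral_const_mul, ← hN] at h1
      have h2 : Real.exp (-X0 * (u - 1)) = Real.exp X0 * Real.exp (-X0 * u) := by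
        rw [← Real.exp_add]; ring_nf
      rw [h2] at h1
      have h3 : 0 ≤ |M1| * (Real.exp X0 * Real.exp (-X0 * u)) := by positivity
      rw [hM2]
      nlinarith
  refine ⟨∫ u in Ioi (0:ℝ), M2 * (Real.exp (-X0 * u) * Real.sinh (b * u)), fun δ hδ => ?_⟩
  obtain ⟨i1, e1⟩ := VV_sinh D X0 hD0 hint δ hδ.1 T b hb0 hbX
  have h : ∫ t in (0:ℝ)..T, Real.cos (b * t) * VV D δ t =
      - ∫ u in Ioi (0:ℝ), Real.sinh (b * u) * VV D (δ + u) T := by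
    rw [e1, VV_fubini D hint δ hδ.1 _ (by fun_prop) T hT.le, ← integral_neg]
    congr 1
    funext x
    by_cases hx : x < X0
    · simp [hD0 _ hx]
    · push Not at hx
      rw [cos_cos_int T b x hb hb0 (by linarith)]
      ring
  rw [h, ← integral_neg]
  apply setIntegral_mono_on i1.neg ((sinh_int b X0 hb0 hbX).1.const_mul _) measurableSet_Ioi
  intro u hu
  have hu' : 0 < u := hu
  have h1 := hlow δ hδ u hu
  have h2 : 0 ≤ Real.sinh (b * u) := Real.sinh_nonneg_iff.mpr (by positivity)
  simp only [Pi.neg_apply]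
  nlinarith

lemma VV_abs_bound (D : ℝ → ℝ) (X0 : ℝ) (hD0 : ∀ x < X0, D x = 0) (hDnn : ∀ x, 0 ≤ D x)
    (hint : ∀ δ > 0, Integrable (fun x => Real.exp (-δ * x) * D x))
    (T b : ℝ) (hT : 0 < T) (hb0 : 0 < b) (hb : b * T = Real.pi / 2) (hbX : b < X0)
    (M1 : ℝ) (hM1 : ∀ δ ∈ Ioc (0:ℝ) 1, -M1 ≤ VV D δ T)
    (G : ℝ → ℝ) (hG : IntegrableOn G (Ioc 0 T)) (hG0 : ∀ t, 0 ≤ G t)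
    (hGV : ∀ δ ∈ Ioc (0:ℝ) 1, ∀ᵐ t ∂(volume.restrict (Ioc 0 T)), - G t ≤ VV D δ t) :
    ∃ M, ∀ δ ∈ Ioc (0:ℝ) 1, ∫ t in (0:ℝ)..(T/2), |VV D δ t| ≤ M := by
  obtain ⟨M, hM⟩ := VV_cos_bound D X0 hD0 hDnn hint T b hT hb0 hb hbX M1 hM1
  refine ⟨2 * (M + ∫ t in (0:ℝ)..T, 2 * G t), fun δ hδ => ?_⟩
  have hc := VV_cont D hint δ hδ.1
  have hGi : IntervalIntegrable G volume 0 T := (intervalIntegrable_iff_integrableOn_Ioc_of_le hT.le).mpr hG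
  have hcos : ∀ t ∈ Ioc 0 T, 0 ≤ Real.cos (b * t) := by
    intro t ht
    apply Real.cos_nonneg_of_mem_Icc
    constructor
    · have := Real.pi_pos
      nlinarith [mul_pos hb0 ht.1]
    · rw [← hb]; exact mul_le_mul_of_nonneg_left ht.2 hb0.le
  have hcos2 : ∀ t ∈ Ioc 0 (T/2), 1/2 ≤ Real.cos (b * t) := by
    intro t ht
    rw [← Real.cos_pi_div_three]
    have := mul_pos hb0 ht.1
    have h2 := mul_le_mul_of_nonneg_left ht.2 hb0.le
    have h3 := Real.pi_pos
    apply Real.cos_le_cos_of_nonneg_of_le_pi <;> nlinarith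
  have i0 : ∀ a c : ℝ, IntervalIntegrable (fun t => Real.cos (b * t) * |VV D δ t|) volume a c := fun a c => by
    apply Continuous.intervalIntegrable; fun_prop
  have i1 : ∀ a c : ℝ, IntervalIntegrable (fun t => Real.cos (b * t) * VV D δ t) volume a c := fun a c => by
    apply Continuous.intervalIntegrable; fun_prop
  have s1 : ∫ t in (0:ℝ)..(T/2), |VV D δ t| ≤ ∫ t in (0:ℝ)..(T/2), 2 * (Real.cos (b * t) * |VV D δ t|) := by
    rw [intervalIntegral.integral_of_le (by linarith), intervalIntegral.integral_of_le (by linarith)]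
    apply setIntegral_mono_on _ _ measurableSet_Ioc
    · intro t ht
      have := hcos2 t ht
      nlinarith [abs_nonneg (VV D δ t)]
    · exact (hc.abs.integrableOn_Icc).mono_set Ioc_subset_Icc_self
    · exact ((intervalIntegrable_iff_integrableOn_Ioc_of_le (by linarith)).mp (i0 0 (T/2))).const_mul 2
  have s2 : ∫ t in (0:ℝ)..(T/2), (Real.cos (b * t) * |VV D δ t|) ≤ ∫ t in (0:ℝ)..T, (Real.cos (b * t) * |VV D δ t|) := by
    rw [intervalIntegral.integral_of_le (by linarith), intervalIntegral.integral_of_le (by linarith)]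
    apply setIntegral_mono_set ((intervalIntegrable_iff_integrableOn_Ioc_of_le (by linarith)).mp (i0 0 T))
    · filter_upwards [ae_restrict_mem measurableSet_Ioc] with t ht
      exact mul_nonneg (hcos t ht) (abs_nonneg _)
    · exact (Ioc_subset_Ioc_right (by linarith)).eventuallyLE
  have s3 : ∫ t in (0:ℝ)..T, (Real.cos (b * t) * |VV D δ t|) ≤ ∫ t in (0:ℝ)..T, (Real.cos (b * t) * VV D δ t + 2 * G t) := by
    rw [intervalIntegral.integral_of_le (by linarith), intervalIntegral.integral_of_le (by linarith)]
    apply integral_mono_ae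
    · exact (intervalIntegrable_iff_integrableOn_Ioc_of_le (by linarith)).mp (i0 0 T)
    · exact (intervalIntegrable_iff_integrableOn_Ioc_of_le (by linarith)).mp ((i1 0 T).add (hGi.const_mul 2))
    · filter_upwards [ae_restrict_mem measurableSet_Ioc, hGV δ hδ] with t ht hg
      have c1 := hcos t ht
      have c2 := Real.cos_le_one (b * t)
      have c3 := hG0 t
      have c4 : |VV D δ t| ≤ VV D δ t + 2 * G t := by
        rw [abs_le]; constructor <;> linarith
      nlinarith [mul_le_mul_of_nonneg_left c4 c1]
  rw [intervalIntegral.integral_add (i1 0 T) (hGi.const_mul 2)] at s3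
  rw [intervalIntegral.integral_const_mul] at s1
  have := hM δ hδ
  linarith

lemma weak_null (W : ℕ → ℝ → ℝ) (L : ℝ) (hL : 0 < L)
    (hW : ∀ n, IntervalIntegrable (W n) volume 0 L)
    (M : ℝ) (hM : ∀ᶠ n in atTop, ∫ t in (0:ℝ)..L, |W n t| ≤ M)
    (hr : ∀ r, 0 < r → r < L → Tendsto (fun n => ∫ t in r..L, |W n t|) atTop (nhds 0))
    (ψ : ℝ → ℝ) (hψ : Continuous ψ) (hψ0 : ψ 0 = 0) :
    Tendsto (fun n => ∫ t in (0:ℝ)..L, ψ t * W n t) atTop (nhds 0) := by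
  rw [Metric.tendsto_atTop']
  intro ε hε
  obtain ⟨B, hB⟩ := (isCompact_Icc (a := (0:ℝ)) (b := L)).exists_bound_of_continuousOn hψ.continuousOn
  set M' := |M| + 1
  have hM' : 0 < M' := by positivity
  have hc : ∀ᶠ t in nhds (0:ℝ), |ψ t| < ε / (2 * M') := by
    have : Tendsto (fun t => |ψ t|) (nhds 0) (nhds |ψ 0|) := (hψ.abs).tendsto 0
    rw [hψ0, abs_zero] at this
    exact this.eventually (gt_mem_nhds (by positivity))
  obtain ⟨r0, hr0, hr1⟩ := Metric.eventually_nhds_iff.mp hc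
  set r := min (r0/2) (L/2) with hrdef
  have rpos : 0 < r := by positivity
  have rL : r < L := by
    have := min_le_right (r0/2) (L/2); linarith
  have rr0 : r < r0 := by
    have := min_le_left (r0/2) (L/2); linarith
  have hB0 : 0 ≤ B := le_trans (norm_nonneg _) (hB 0 ⟨le_rfl, hL.le⟩)
  have hlim : ∀ᶠ n in atTop, ∫ t in r..L, |W n t| < ε / (2 * (B + 1)) :=
    (hr r rpos rL).eventually (gt_mem_nhds (by positivity))
  obtain ⟨N, hN⟩ := eventually_atTop.mp (hM.and hlim)
  refine ⟨N, fun n hn => ?_⟩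
  obtain ⟨h1, h2⟩ := hN n hn.le
  rw [Real.dist_eq, sub_zero]
  have iW : ∀ a b, 0 ≤ a → a ≤ b → b ≤ L → IntervalIntegrable (W n) volume a b := fun a b h0 h1 h2 =>
    (hW n).mono_set (by rw [uIcc_of_le h1, uIcc_of_le hL.le]; exact Icc_subset_Icc h0 h2)
  have iP : ∀ a b, 0 ≤ a → a ≤ b → b ≤ L → IntervalIntegrable (fun t => ψ t * W n t) volume a b := fun a b h0 h1 h2 =>
    (iW a b h0 h1 h2).continuousOn_mul hψ.continuousOn
  rw [← intervalIntegral.integral_add_adjacent_intervals (iP 0 r le_rfl rpos.le rL.le) (iP r L rpos.le rL.le le_rfl)]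
  have b1 : |∫ t in (0:ℝ)..r, ψ t * W n t| ≤ ε / (2 * M') * ∫ t in (0:ℝ)..r, |W n t| := by
    rw [← intervalIntegral.integral_const_mul, ← Real.norm_eq_abs]
    apply intervalIntegral.norm_integral_le_of_norm_le rpos.le
    · refine Eventually.of_forall fun t ht => ?_
      rw [norm_mul, Real.norm_eq_abs, Real.norm_eq_abs]
      apply mul_le_mul_of_nonneg_right _ (abs_nonneg _)
      apply (hr1 _).le
      rw [Real.dist_eq, sub_zero, abs_of_pos ht.1]
      linarith [ht.2]
    · exact (iW 0 r le_rfl rpos.le rL.le).abs.const_mul _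
  have b2 : |∫ t in r..L, ψ t * W n t| ≤ B * ∫ t in r..L, |W n t| := by
    rw [← intervalIntegral.integral_const_mul, ← Real.norm_eq_abs]
    apply intervalIntegral.norm_integral_le_of_norm_le rL.le
    · refine Eventually.of_forall fun t ht => ?_
      rw [norm_mul, Real.norm_eq_abs (W n t)]
      apply mul_le_mul_of_nonneg_right _ (abs_nonneg _)
      exact hB t ⟨by linarith [ht.1], ht.2⟩
    · exact (iW r L rpos.le rL.le le_rfl).abs.const_mul _
  have b3 : ∫ t in (0:ℝ)..r, |W n t| ≤ M' := by
    have e := intervalIntegral.integral_add_adjacent_intervals (iW 0 r le_rfl rpos.le rL.le).abs (iW r L rpos.le rL.le le_rfl).abs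
    have e2 : 0 ≤ ∫ t in r..L, |W n t| := intervalIntegral.integral_nonneg rL.le fun t _ => abs_nonneg _
    have := le_abs_self M
    linarith
  have b4 : ε / (2 * M') * ∫ t in (0:ℝ)..r, |W n t| ≤ ε / 2 := by
    calc _ ≤ ε / (2 * M') * M' := mul_le_mul_of_nonneg_left b3 (by positivity)
      _ = ε / 2 := by field_simp
  have b5 : B * ∫ t in r..L, |W n t| < ε / 2 := by
    have e2 : 0 ≤ ∫ t in r..L, |W n t| := intervalIntegral.integral_nonneg rL.le fun t _ => abs_nonneg _
    calc _ ≤ (B + 1) * ∫ t in r..L, |W n t| := mul_le_mul_of_nonneg_right (by linarith) e2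
      _ < (B + 1) * (ε / (2 * (B + 1))) := mul_lt_mul_of_pos_left h2 (by positivity)
      _ = ε / 2 := by field_simp
  have := abs_add_le (∫ t in (0:ℝ)..r, ψ t * W n t) (∫ t in r..L, ψ t * W n t)
  linarith

lemma weak_limit (V : ℝ → ℝ → ℝ) (hV : ∀ δ > 0, Continuous (V δ)) (τ : ℝ) (hτ : 0 < τ)
    (M : ℝ) (hM : ∀ δ ∈ Ioc (0:ℝ) 1, ∫ t in (0:ℝ)..τ, |V δ t| ≤ M)
    (F : ℝ → ℝ) (hF : ∀ r L, 0 < r → r ≤ L → IntegrableOn F (Ioc r L) ∧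
      Tendsto (fun δ => ∫ t in r..L, |V δ t - F t|) (nhdsWithin 0 (Ioi 0)) (nhds 0)) :
    ∃ A : ℝ, ∃ δ : ℕ → ℝ, (∀ n, 0 < δ n) ∧ Tendsto δ atTop (nhds 0) ∧ ∀ L ≥ τ,
      IntervalIntegrable F volume 0 L ∧
      ∀ φ : ℝ → ℝ, Continuous φ → Tendsto (fun n => ∫ t in (0:ℝ)..L, φ t * V (δ n) t) atTop
        (nhds (φ 0 * A + ∫ t in (0:ℝ)..L, φ t * F t)) := by
  have iF : ∀ r L, 0 < r → r ≤ L → IntervalIntegrable F volume r L := fun r L h1 h2 =>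
    (intervalIntegrable_iff_integrableOn_Ioc_of_le h2).mpr (hF r L h1 h2).1
  have iV : ∀ δ > 0, ∀ a b, IntervalIntegrable (V δ) volume a b := fun δ h a b => (hV δ h).intervalIntegrable a b
  have hFb : ∀ r, 0 < r → r ≤ τ → ∫ t in r..τ, ‖F t‖ ≤ M := by
    intro r h1 h2
    have key : ∀ᶠ δ in nhdsWithin (0:ℝ) (Ioi 0), ∫ t in r..τ, ‖F t‖ ≤ M + ∫ t in r..τ, |V δ t - F t| := by
      have hmem : Ioc (0:ℝ) 1 ∈ nhdsWithin (0:ℝ) (Ioi 0) := Ioc_mem_nhdsGT one_pos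
      filter_upwards [hmem] with δ hδ
      have c1 : ∫ t in r..τ, |V δ t| ≤ ∫ t in (0:ℝ)..τ, |V δ t| := by
        rw [← intervalIntegral.integral_add_adjacent_intervals (iV δ hδ.1 0 r).abs (iV δ hδ.1 r τ).abs]
        have : 0 ≤ ∫ t in (0:ℝ)..r, |V δ t| := intervalIntegral.integral_nonneg h1.le fun t _ => abs_nonneg _
        linarith
      have c2 : ∫ t in r..τ, ‖F t‖ ≤ ∫ t in r..τ, (|V δ t| + |V δ t - F t|) := by
        apply intervalIntegral.integral_mono_on h2 (iF r τ h1 h2).norm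
        · exact (iV δ hδ.1 r τ).abs.add ((iV δ hδ.1 r τ).sub (iF r τ h1 h2)).abs
        · intro t _
          have := abs_sub (V δ t) (V δ t - F t)
          rwa [sub_sub_cancel] at this
      rw [intervalIntegral.integral_add (iV δ hδ.1 r τ).abs ((iV δ hδ.1 r τ).sub (iF r τ h1 h2)).abs] at c2
      have := hM δ hδ
      linarith
    have lim : Tendsto (fun δ => M + ∫ t in r..τ, |V δ t - F t|) (nhdsWithin 0 (Ioi 0)) (nhds (M + 0)) :=
      tendsto_const_nhds.add (hF r τ h1 h2).2
    rw [add_zero] at lim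
    exact ge_of_tendsto lim key
  have iF0 : IntervalIntegrable F volume 0 τ := by
    rw [intervalIntegrable_iff_integrableOn_Ioc_of_le hτ.le]
    have ha : Tendsto (fun n : ℕ => τ / ((n:ℝ) + 1)) atTop (nhds 0) := by
      have := (tendsto_one_div_add_atTop_nhds_zero_nat (𝕜 := ℝ)).const_mul τ
      simpa [div_eq_mul_inv] using this
    have hle : ∀ n : ℕ, τ / ((n:ℝ) + 1) ≤ τ := fun n => by
      apply div_le_self hτ.le; have : (0:ℝ) ≤ n := n.cast_nonneg
      linarith
    apply integrableOn_Ioc_of_intervalIntegral_norm_bounded_left (l := atTop) (I := M)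
      (a := fun n : ℕ => τ / ((n:ℝ) + 1)) ?_ ha
    · refine Eventually.of_forall fun n => ?_
      have := hFb _ (by positivity) (hle n)
      rwa [intervalIntegral.integral_of_le (hle n)] at this
    · intro n
      exact (hF _ τ (by positivity) (hle n)).1
  have iFL : ∀ L ≥ τ, IntervalIntegrable F volume 0 L := fun L hL => iF0.trans (iF τ L hτ hL)
  -- the subsequence
  let d : ℕ → ℝ := fun n => 1 / ((n:ℝ) + 1)
  have hd0 : ∀ n, 0 < d n := fun n => by positivity
  have hd1 : ∀ n, d n ≤ 1 := fun n => by
    have : (0:ℝ) ≤ n := n.cast_nonneg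
    exact (div_le_one (by positivity)).mpr (by linarith)
  have hd : Tendsto d atTop (nhds 0) := tendsto_one_div_add_atTop_nhds_zero_nat
  have hbd : ∀ n, (∫ t in (0:ℝ)..τ, V (d n) t) ∈ Metric.closedBall (0:ℝ) M := by
    intro n
    rw [mem_closedBall_zero_iff]
    exact (intervalIntegral.norm_integral_le_integral_norm hτ.le).trans (hM (d n) ⟨hd0 n, hd1 n⟩)
  obtain ⟨A0, -, ph, hph, hA0⟩ := tendsto_subseq_of_bounded Metric.isBounded_closedBall hbd
  have hdp : Tendsto (fun n => d (ph n)) atTop (nhds 0) := hd.comp hph.tendsto_atTop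
  have hdp' : Tendsto (fun n => d (ph n)) atTop (nhdsWithin 0 (Ioi 0)) :=
    tendsto_nhdsWithin_iff.mpr ⟨hdp, Eventually.of_forall fun n => hd0 _⟩
  refine ⟨A0 - ∫ t in (0:ℝ)..τ, F t, fun n => d (ph n), fun n => hd0 _, hdp, fun L hL => ⟨iFL L hL, fun φ hφ => ?_⟩⟩
  have hL0 : 0 < L := hτ.trans_le hL
  set W : ℕ → ℝ → ℝ := fun n t => V (d (ph n)) t - F t with hWdef
  have iW : ∀ n, ∀ L ≥ τ, IntervalIntegrable (W n) volume 0 L := fun n L hL => (iV _ (hd0 _) 0 L).sub (iFL L hL)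
  have iW2 : ∀ n r L, 0 < r → r ≤ L → IntervalIntegrable (W n) volume r L := fun n r L h1 h2 =>
    (iV _ (hd0 _) r L).sub (iF r L h1 h2)
  have hWr : ∀ r L, 0 < r → r ≤ L → Tendsto (fun n => ∫ t in r..L, |W n t|) atTop (nhds 0) := fun r L h1 h2 =>
    (hF r L h1 h2).2.comp hdp'
  have hWb : ∀ᶠ n in atTop, ∫ t in (0:ℝ)..L, |W n t| ≤ (M + ∫ t in (0:ℝ)..τ, |F t|) + 1 := by
    filter_upwards [(hWr τ L hτ hL).eventually (gt_mem_nhds one_pos)] with n hn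
    rw [← intervalIntegral.integral_add_adjacent_intervals (iW n τ le_rfl).abs (iW2 n τ L hτ hL).abs]
    have c1 : ∫ t in (0:ℝ)..τ, |W n t| ≤ ∫ t in (0:ℝ)..τ, (|V (d (ph n)) t| + |F t|) := by
      apply intervalIntegral.integral_mono_on hτ.le (iW n τ le_rfl).abs
      · exact (iV _ (hd0 _) 0 τ).abs.add iF0.abs
      · intro t _
        exact abs_sub _ _
    rw [intervalIntegral.integral_add (iV _ (hd0 _) 0 τ).abs iF0.abs] at c1
    have := hM _ ⟨hd0 (ph n), hd1 _⟩
    linarith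
  have hW0 : Tendsto (fun n => ∫ t in (0:ℝ)..L, W n t) atTop (nhds (A0 - ∫ t in (0:ℝ)..τ, F t)) := by
    have e : ∀ n, ∫ t in (0:ℝ)..L, W n t = ((∫ t in (0:ℝ)..τ, V (d (ph n)) t) - ∫ t in (0:ℝ)..τ, F t) + ∫ t in τ..L, W n t := by
      intro n
      rw [← intervalIntegral.integral_add_adjacent_intervals (iW n τ le_rfl) (iW2 n τ L hτ hL),
        ← intervalIntegral.integral_sub (iV _ (hd0 _) 0 τ) iF0]
    simp only [e]
    have t1 : Tendsto (fun n => ∫ t in τ..L, W n t) atTop (nhds 0) :=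
      squeeze_zero_norm (fun n => intervalIntegral.norm_integral_le_integral_norm hL) (hWr τ L hτ hL)
    simpa using (hA0.sub_const _).add t1
  have hnull := weak_null W L hL0 (fun n => iW n L hL) _ hWb (fun r h1 h2 => hWr r L h1 h2.le)
    (fun t => φ t - φ 0) (by fun_prop) (by simp)
  have e : ∀ n, ∫ t in (0:ℝ)..L, φ t * V (d (ph n)) t =
      (∫ t in (0:ℝ)..L, (φ t - φ 0) * W n t) + (φ 0 * ∫ t in (0:ℝ)..L, W n t) + ∫ t in (0:ℝ)..L, φ t * F t := by
    intro n
    have j1 : IntervalIntegrable (fun t => (φ t - φ 0) * W n t) volume 0 L :=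
      (iW n L hL).continuousOn_mul (Continuous.continuousOn (by fun_prop))
    have j2 : IntervalIntegrable (fun t => φ t * F t) volume 0 L :=
      (iFL L hL).continuousOn_mul hφ.continuousOn
    rw [← intervalIntegral.integral_const_mul, ← intervalIntegral.integral_add j1 ((iW n L hL).const_mul _),
      ← intervalIntegral.integral_add (j1.add ((iW n L hL).const_mul _)) j2]
    congr 1
    funext t
    simp only [hWdef]
    ring
  simp only [e]
  simpa using (hnull.add (hW0.const_mul (φ 0))).add_const (∫ t in (0:ℝ)..L, φ t * F t)

lemma riemann_lebesgue_cos (f : ℝ → ℝ) (hf : Integrable f) :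
    Tendsto (fun y : ℝ => ∫ t, Real.cos (t * y) * f t) atTop (nhds 0) := by
  have h := Real.tendsto_integral_exp_smul_cocompact (fun t => (f t : ℂ))
  have h2 : Tendsto (fun y : ℝ => y / (2 * Real.pi)) atTop (cocompact ℝ) :=
    (tendsto_id.atTop_div_const (by positivity)).mono_right atTop_le_cocompact
  have h3 := (Complex.continuous_re.tendsto _).comp (h.comp h2)
  simp only [Complex.zero_re] at h3
  refine h3.congr fun y => ?_
  simp only [Function.comp_apply]
  have hi : Integrable (fun v : ℝ => Real.fourierChar (-(v * (y / (2 * Real.pi)))) • (f v : ℂ)) := by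
    have := (hf.ofReal (𝕜 := ℂ))
    exact (Real.fourierIntegral_convergent_iff' (V := ℝ) (innerSL ℝ) (y / (2 * Real.pi))).mpr this |>.congr (by
      refine Eventually.of_forall fun v => ?_
      change Real.fourierChar (-(inner ℝ v (y / (2 * Real.pi)))) • (f v : ℂ) = _
      simp [mul_comm])
  have h4 := (integral_re hi)
  simp only [RCLike.re_to_complex] at h4
  rw [← h4]
  congr 1
  funext t
  rw [Circle.smul_def, Real.fourierChar_apply, smul_eq_mul, Complex.re_mul_ofReal, Complex.exp_ofReal_mul_I_re,
    show 2 * Real.pi * -(t * (y / (2 * Real.pi))) = -(t * y) by field_simp, Real.cos_neg]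

lemma D_meas (D : ℝ → ℝ) (hint : ∀ δ > 0, Integrable (fun x => Real.exp (-δ * x) * D x)) :
    AEStronglyMeasurable D := by
  have h1 := (hint 1 one_pos).aestronglyMeasurable
  have h2 : AEStronglyMeasurable (fun x : ℝ => Real.exp x) := Real.continuous_exp.aestronglyMeasurable
  refine (h2.mul h1).congr (Eventually.of_forall fun x => ?_)
  simp only [Pi.mul_apply]
  rw [← mul_assoc, ← Real.exp_add]
  simp

lemma abel_limit (D : ℝ → ℝ) (hD0 : ∀ x < 0, D x = 0) (hDnn : ∀ x, 0 ≤ D x)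
    (hint : ∀ δ > 0, Integrable (fun x => Real.exp (-δ * x) * D x))
    (P : ℝ → ℝ) (hP : Continuous P) (hP0 : ∀ x, 0 ≤ P x) (B : ℝ) (hPB : ∀ x, P x ≤ B)
    (δ : ℕ → ℝ) (hδ : ∀ n, 0 < δ n) (hδ0 : Tendsto δ atTop (nhds 0)) (l : ℝ)
    (hl : Tendsto (fun n => ∫ x, Real.exp (-δ n * x) * D x * P x) atTop (nhds l)) :
    Integrable (fun x => D x * P x) ∧ ∫ x, D x * P x = l := by
  have hi : ∀ n, Integrable (fun x => Real.exp (-δ n * x) * D x * P x) := fun n =>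
    (hint _ (hδ n)).mul_bdd (c := B) hP.aestronglyMeasurable
      (Eventually.of_forall fun x => by rw [Real.norm_of_nonneg (hP0 x)]; exact hPB x)
  have hm : AEStronglyMeasurable (fun x => D x * P x) := (D_meas D hint).mul hP.aestronglyMeasurable
  have hnn : ∀ x, 0 ≤ D x * P x := fun x => mul_nonneg (hDnn x) (hP0 x)
  have hnn' : ∀ n x, 0 ≤ Real.exp (-δ n * x) * D x * P x := fun n x =>
    mul_nonneg (mul_nonneg (Real.exp_pos _).le (hDnn x)) (hP0 x)
  have hpt : ∀ x, Tendsto (fun n => Real.exp (-δ n * x) * D x * P x) atTop (nhds (D x * P x)) := by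
    intro x
    have h1 : Tendsto (fun n => Real.exp (-δ n * x)) atTop (nhds (Real.exp (-0 * x))) :=
      (Real.continuous_exp.tendsto _).comp ((hδ0.neg).mul_const x)
    simp only [neg_zero, zero_mul, Real.exp_zero] at h1
    simpa using (h1.mul_const (D x)).mul_const (P x)
  have hI : Integrable (fun x => D x * P x) := by
    refine ⟨hm, ?_⟩
    rw [hasFiniteIntegral_iff_ofReal (Eventually.of_forall hnn)]
    have h1 := lintegral_liminf_le' (u := atTop) (μ := (volume : Measure ℝ)) (f := fun (n : ℕ) x => ENNReal.ofReal (Real.exp (-δ n * x) * D x * P x))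
      (fun n => (hi n).aestronglyMeasurable.aemeasurable.ennreal_ofReal)
    have h2 : ∀ x, liminf (fun n => ENNReal.ofReal (Real.exp (-δ n * x) * D x * P x)) atTop = ENNReal.ofReal (D x * P x) :=
      fun x => ((ENNReal.continuous_ofReal.tendsto _).comp (hpt x)).liminf_eq
    have h3 : liminf (fun n => ∫⁻ x, ENNReal.ofReal (Real.exp (-δ n * x) * D x * P x)) atTop = ENNReal.ofReal l := by
      have : ∀ n, ∫⁻ x, ENNReal.ofReal (Real.exp (-δ n * x) * D x * P x) = ENNReal.ofReal (∫ x, Real.exp (-δ n * x) * D x * P x) :=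
        fun n => (ofReal_integral_eq_lintegral_ofReal (hi n) (Eventually.of_forall (hnn' n))).symm
      simp only [this]
      exact ((ENNReal.continuous_ofReal.tendsto _).comp hl).liminf_eq
    simp only [h2, h3] at h1
    exact h1.trans_lt ENNReal.ofReal_lt_top
  refine ⟨hI, ?_⟩
  refine tendsto_nhds_unique ?_ hl
  apply tendsto_integral_of_dominated_convergence _ (fun n => (hi n).aestronglyMeasurable) hI
  · intro n
    refine Eventually.of_forall fun x => ?_
    rw [Real.norm_of_nonneg (hnn' n x)]
    by_cases hx : x < 0
    · simp [hD0 x hx]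
    · push Not at hx
      have : Real.exp (-δ n * x) ≤ 1 := Real.exp_le_one_iff.mpr (by nlinarith [hδ n])
      rw [mul_assoc]
      nlinarith [hnn x]
  · exact Eventually.of_forall hpt

/-- the Fejer averages of `D` -/
noncomputable def QQ (D : ℝ → ℝ) (L y : ℝ) : ℝ := ∫ x, D x * (L / 4 * (Kf (L * (x - y)) + Kf (L * (x + y))))

lemma core_Q (D : ℝ → ℝ) (X0 : ℝ) (hD0 : ∀ x < X0, D x = 0) (hDnn : ∀ x, 0 ≤ D x)
    (hint : ∀ δ > 0, Integrable (fun x => Real.exp (-δ * x) * D x))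
    (T b : ℝ) (hT : 0 < T) (hb0 : 0 < b) (hb : b * T = Real.pi / 2) (hbX : b < X0)
    (M1 : ℝ) (hM1 : ∀ δ ∈ Ioc (0:ℝ) 1, -M1 ≤ VV D δ T)
    (G : ℝ → ℝ) (hG : IntegrableOn G (Ioc 0 T)) (hG0 : ∀ t, 0 ≤ G t)
    (hGV : ∀ δ ∈ Ioc (0:ℝ) 1, ∀ᵐ t ∂(volume.restrict (Ioc 0 T)), - G t ≤ VV D δ t)
    (F : ℝ → ℝ) (hF : ∀ r L, 0 < r → r ≤ L → IntegrableOn F (Ioc r L) ∧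
      Tendsto (fun δ => ∫ t in r..L, |VV D δ t - F t|) (nhdsWithin 0 (Ioi 0)) (nhds 0)) :
    ∃ A : ℝ, ∀ L ≥ T / 2, (∀ y, Integrable (fun x => D x * (L / 4 * (Kf (L * (x - y)) + Kf (L * (x + y)))))) ∧
      Tendsto (QQ D L) atTop (nhds A) := by
  obtain ⟨M, hM⟩ := VV_abs_bound D X0 hD0 hDnn hint T b hT hb0 hb hbX M1 hM1 G hG hG0 hGV
  obtain ⟨A, δ, hδ, hδ0, h⟩ := weak_limit (VV D) (fun δ hδ => VV_cont D hint δ hδ) (T/2) (by positivity) M hM F hF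
  refine ⟨A, fun L hL => ?_⟩
  have hL0 : 0 < L := by linarith
  obtain ⟨iF, hφ⟩ := h L hL
  have key : ∀ y, Integrable (fun x => D x * (L / 4 * (Kf (L * (x - y)) + Kf (L * (x + y))))) ∧
      QQ D L y = A + ∫ t in (0:ℝ)..L, (1 - t / L) * Real.cos (t * y) * F t := by
    intro y
    have h1 := hφ (fun t => (1 - t / L) * Real.cos (t * y)) (by fun_prop)
    have h2 : ∀ n, ∫ t in (0:ℝ)..L, (1 - t / L) * Real.cos (t * y) * VV D (δ n) t =
        ∫ x, Real.exp (-δ n * x) * D x * (L / 4 * (Kf (L * (x - y)) + Kf (L * (x + y)))) := by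
      intro n
      rw [VV_fubini D hint (δ n) (hδ n) (fun t => (1 - t / L) * Real.cos (t * y)) (by fun_prop) L hL0.le]
      simp only [Kf_cc L hL0]
    simp only [h2] at h1
    have hK := Kf_cont
    have := abel_limit D (fun x hx => hD0 x (by linarith)) hDnn hint
      (fun x => L / 4 * (Kf (L * (x - y)) + Kf (L * (x + y)))) (by fun_prop)
      (fun x => by have := Kf_nonneg (L * (x - y)); have := Kf_nonneg (L * (x + y)); positivity) (L / 4 * (8 + 8))
      (fun x => mul_le_mul_of_nonneg_left (add_le_add (Kf_le8 _) (Kf_le8 _)) (by positivity)) δ hδ hδ0 _ h1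
    refine ⟨this.1, ?_⟩
    rw [QQ, this.2]
    simp
  refine ⟨fun y => (key y).1, ?_⟩
  have e : QQ D L = fun y => A + ∫ t in (0:ℝ)..L, (1 - t / L) * Real.cos (t * y) * F t := funext fun y => (key y).2
  rw [e]
  have hi : IntegrableOn (fun t => (1 - t / L) * F t) (Ioc 0 L) :=
    (intervalIntegrable_iff_integrableOn_Ioc_of_le hL0.le).mp
      (iF.continuousOn_mul (f := F) (g := fun t => 1 - t / L) (Continuous.continuousOn (by fun_prop)))
  have hRL := riemann_lebesgue_cos _ ((integrable_indicator_iff measurableSet_Ioc).mpr hi)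
  have e2 : ∀ y, ∫ t in (0:ℝ)..L, (1 - t / L) * Real.cos (t * y) * F t =
      ∫ t, Real.cos (t * y) * (Ioc 0 L).indicator (fun t => (1 - t / L) * F t) t := by
    intro y
    rw [intervalIntegral.integral_of_le hL0.le, ← integral_indicator measurableSet_Ioc]
    congr 1
    funext t
    by_cases ht : t ∈ Ioc 0 L
    · simp only [indicator_of_mem ht]; ring
    · simp only [indicator_of_notMem ht]; ring
  simp only [e2]
  simpa using hRL.const_add A

lemma Kf_win (L c h : ℝ) (hL : 0 < L) :
    ∫ x in (c - h)..(c + h), L / 4 * Kf (L * (x - c)) = (∫ z in (-(L * h))..(L * h), Kf z) / 4 := by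
  have h1 : ∀ x, L / 4 * Kf (L * (x - c)) = L / 4 * Kf (L * x - L * c) := fun x => by rw [mul_sub]
  simp only [h1]
  rw [intervalIntegral.integral_const_mul, intervalIntegral.integral_comp_mul_sub Kf hL.ne',
    show L * (c - h) - L * c = -(L * h) by ring, show L * (c + h) - L * c = L * h by ring, smul_eq_mul]
  field_simp

lemma Kf_tot (L c : ℝ) (hL : 0 < L) : Integrable (fun x => L / 4 * Kf (L * (x - c))) ∧
    ∫ x, L / 4 * Kf (L * (x - c)) = (∫ z, Kf z) / 4 := by
  constructor
  · exact ((Kf_int.comp_mul_left' hL.ne').comp_sub_right c).const_mul _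
  · rw [integral_const_mul, integral_sub_right_eq_self (fun x => Kf (L * x)) c,
      Measure.integral_comp_mul_left Kf L, abs_of_pos (inv_pos.mpr hL), smul_eq_mul]
    field_simp

lemma Kf_win_lim : Tendsto (fun R : ℝ => ∫ z in (-R)..R, Kf z) atTop (nhds (∫ z, Kf z)) :=
  intervalIntegral_tendsto_integral Kf_int tendsto_neg_atTop_atBot tendsto_id

lemma Kf_choose (ε h L0 : ℝ) (hε : 0 < ε) (hh : 0 < h) :
    ∃ L ≥ L0, 0 < L ∧ (1 - ε) * (∫ z, Kf z) ≤ ∫ z in (-(L * h))..(L * h), Kf z := by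
  have h1 : (1 - ε) * (∫ z, Kf z) < ∫ z, Kf z := by nlinarith [Kf_pos]
  have h2 : Tendsto (fun L : ℝ => L * h) atTop atTop := tendsto_id.atTop_mul_const hh
  have h3 := (Kf_win_lim.comp h2).eventually (lt_mem_nhds h1)
  obtain ⟨L, hL⟩ := (h3.and ((eventually_ge_atTop L0).and (eventually_gt_atTop 0))).exists
  exact ⟨L, hL.2.1, hL.2.2, hL.1.le⟩

lemma Kf_tendsto_zero (f : ℝ → ℝ) (hf : Tendsto f atTop atTop) : Tendsto (fun y => Kf (f y)) atTop (nhds 0) := by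
  have h1 : Tendsto (fun y => 1 + f y ^ 2) atTop atTop :=
    tendsto_atTop_add_const_left _ _ ((tendsto_pow_atTop two_ne_zero).comp hf)
  have h2 := (tendsto_inv_atTop_zero.comp h1).const_mul 8
  rw [mul_zero] at h2
  exact squeeze_zero (fun y => Kf_nonneg _) (fun y => Kf_le _) h2

lemma Kf_neg (x : ℝ) : Kf (-x) = Kf x := by
  unfold Kf
  simp

lemma tauber_upper (D : ℝ → ℝ) (hDnn : ∀ x, 0 ≤ D x)
    (hdecr : ∀ ε, 0 < ε → ε < 1 → ∃ h > 0, ∃ x1, ∀ x y, x1 ≤ x → x ≤ y → y ≤ x + h → (1 - ε) * D x - ε ≤ D y)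
    (A L0 : ℝ) (hQi : ∀ L ≥ L0, ∀ y, Integrable (fun x => D x * (L / 4 * (Kf (L * (x - y)) + Kf (L * (x + y))))))
    (hQ : ∀ L ≥ L0, Tendsto (QQ D L) atTop (nhds A)) (ε : ℝ) (hε : 0 < ε) (hε1 : ε < 1) :
    ∀ᶠ y in atTop, ((1 - ε) * D y - ε) * ((1 - ε) * (∫ z, Kf z) / 4) ≤ A + ε := by
  obtain ⟨h, hh, x1, hd⟩ := hdecr ε hε hε1
  obtain ⟨L, hLL, hL, hw⟩ := Kf_choose ε (h/2) L0 hε (by positivity)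
  have h1 : ∀ᶠ y in atTop, QQ D L (y + h / 2) < A + ε :=
    ((hQ L hLL).comp (tendsto_atTop_add_const_right _ (h/2) tendsto_id)).eventually (gt_mem_nhds (by linarith))
  filter_upwards [h1, eventually_ge_atTop x1] with y hy hyx
  set m := max 0 ((1 - ε) * D y - ε) with hm
  have hm0 : 0 ≤ m := le_max_left _ _
  have hm1 : (1 - ε) * D y - ε ≤ m := le_max_right _ _
  set c := y + h / 2 with hc
  have hnn : ∀ x, 0 ≤ D x * (L / 4 * (Kf (L * (x - c)) + Kf (L * (x + c)))) := fun x => by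
    have := Kf_nonneg (L * (x - c)); have := Kf_nonneg (L * (x + c)); have := hDnn x; positivity
  have b1 : ∫ x in Ioc (c - h/2) (c + h/2), D x * (L / 4 * (Kf (L * (x - c)) + Kf (L * (x + c)))) ≤ QQ D L c :=
    setIntegral_le_integral (hQi L hLL c) (Eventually.of_forall hnn)
  have b2 : ∫ x in Ioc (c - h/2) (c + h/2), m * (L / 4 * Kf (L * (x - c))) ≤
      ∫ x in Ioc (c - h/2) (c + h/2), D x * (L / 4 * (Kf (L * (x - c)) + Kf (L * (x + c)))) := by
    apply setIntegral_mono_on ((Kf_tot L c hL).1.const_mul m).integrableOn (hQi L hLL c).integrableOn measurableSet_Ioc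
    intro x hx
    have hx1 : y < x := by have := hx.1; rw [hc] at this; linarith
    have hx2 : x ≤ y + h := by have := hx.2; rw [hc] at this; linarith
    have hDx : m ≤ D x := max_le (hDnn x) (hd y x hyx hx1.le hx2)
    have k1 := Kf_nonneg (L * (x - c)); have k2 := Kf_nonneg (L * (x + c))
    apply mul_le_mul hDx _ (by positivity) (hDnn x)
    apply mul_le_mul_of_nonneg_left _ (by positivity)
    linarith
  rw [integral_const_mul, ← intervalIntegral.integral_of_le (by linarith), Kf_win L c (h/2) hL] at b2
  have hk := Kf_pos
  have b3 : ((1 - ε) * D y - ε) * ((1 - ε) * (∫ z, Kf z) / 4) ≤ m * ((1 - ε) * (∫ z, Kf z) / 4) := by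
    apply mul_le_mul_of_nonneg_right hm1
    have : 0 < 1 - ε := by linarith
    positivity
  have b4 : m * ((1 - ε) * (∫ z, Kf z) / 4) ≤ m * ((∫ z in (-(L * (h/2)))..(L * (h/2)), Kf z) / 4) := by
    apply mul_le_mul_of_nonneg_left _ hm0
    linarith
  linarith

lemma tauber_lower (D : ℝ → ℝ) (hD0 : ∀ x < 0, D x = 0) (hDnn : ∀ x, 0 ≤ D x)
    (hint : ∀ δ > 0, Integrable (fun x => Real.exp (-δ * x) * D x))
    (hdecr : ∀ ε, 0 < ε → ε < 1 → ∃ h > 0, ∃ x1, ∀ x y, x1 ≤ x → x ≤ y → y ≤ x + h → (1 - ε) * D x - ε ≤ D y)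
    (A L0 : ℝ) (hQi : ∀ L ≥ L0, ∀ y, Integrable (fun x => D x * (L / 4 * (Kf (L * (x - y)) + Kf (L * (x + y))))))
    (hQ : ∀ L ≥ L0, Tendsto (QQ D L) atTop (nhds A))
    (M y0 : ℝ) (hy0 : 0 ≤ y0) (hM : ∀ x ≥ y0, D x ≤ M)
    (ε : ℝ) (hε : 0 < ε) (hε1 : ε < 1) :
    ∀ᶠ y in atTop, A - ε ≤ (D y + ε) / (1 - ε) * ((∫ z, Kf z) / 4) + M * (ε * ((∫ z, Kf z) / 4)) + ε := by
  obtain ⟨h, hh, x1, hd⟩ := hdecr ε hε hε1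
  obtain ⟨L, hLL, hL, hw⟩ := Kf_choose ε (h/2) L0 hε (by positivity)
  have hM0 : 0 ≤ M := (hDnn y0).trans (hM y0 le_rfl)
  have hK := Kf_cont
  set D1 : ℝ → ℝ := (Iio y0).indicator D with hD1
  have hD1nn : ∀ x, 0 ≤ D1 x := fun x => indicator_nonneg (fun x _ => hDnn x) x
  have iD1 : Integrable D1 := by
    refine ((hint 1 one_pos).norm.const_mul (Real.exp y0)).mono' ((D_meas D hint).indicator measurableSet_Iio) ?_
    refine Eventually.of_forall fun x => ?_
    rw [Real.norm_of_nonneg (hD1nn x), norm_mul, Real.norm_eq_abs, Real.abs_exp, Real.norm_of_nonneg (hDnn x),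
      ← mul_assoc, ← Real.exp_add]
    by_cases hx : x < y0
    · rw [hD1, indicator_of_mem (by exact hx)]
      have : 1 ≤ Real.exp (y0 + -1 * x) := Real.one_le_exp (by linarith)
      nlinarith [hDnn x]
    · rw [hD1, indicator_of_notMem (by exact hx)]
      have := hDnn x; positivity
  set J : ℝ → ℝ → ℝ := fun c x => D1 x * (L / 4 * (Kf (L * (x - c)) + Kf (L * (x + c)))) +
    (Ici (0:ℝ)).indicator (fun x => M * (L / 4 * Kf (L * (x + c)))) x with hJ
  have hJm : ∀ c, AEStronglyMeasurable (J c) := fun c => by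
    refine (iD1.aestronglyMeasurable.mul (Continuous.aestronglyMeasurable (by fun_prop))).add
      ((Continuous.aestronglyMeasurable (by fun_prop)).indicator measurableSet_Ici)
  have hJnn : ∀ c x, 0 ≤ J c x := fun c x => by
    have k1 := Kf_nonneg (L * (x - c)); have k2 := Kf_nonneg (L * (x + c))
    have := hD1nn x
    refine add_nonneg (by positivity) (indicator_nonneg (fun x _ => ?_) x)
    have k2 := Kf_nonneg (L * (x + c))
    positivity
  set bd : ℝ → ℝ := fun x => D1 x * (L / 4 * (8 + 8)) + M * (L / 4 * (8 * (1 + (L * x) ^ 2)⁻¹)) with hbd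
  have ibd : Integrable bd := by
    refine (iD1.mul_const _).add (Integrable.const_mul (Integrable.const_mul (Integrable.const_mul ?_ _) _) _)
    exact integrable_inv_one_add_sq.comp_mul_left' hL.ne'
  have hJbd : ∀ c ≥ 0, ∀ x, J c x ≤ bd x := by
    intro c hc x
    refine add_le_add ?_ ?_
    · apply mul_le_mul_of_nonneg_left _ (hD1nn x)
      exact mul_le_mul_of_nonneg_left (add_le_add (Kf_le8 _) (Kf_le8 _)) (by positivity)
    · by_cases hx : 0 ≤ x
      · rw [indicator_of_mem (by exact hx)]
        refine mul_le_mul_of_nonneg_left (mul_le_mul_of_nonneg_left ((Kf_le _).trans ?_) (by positivity)) hM0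
        have : (1 + (L * (x + c)) ^ 2)⁻¹ ≤ (1 + (L * x) ^ 2)⁻¹ := by
          apply inv_anti₀ (by positivity)
          have : (L * x) ^ 2 ≤ (L * (x + c)) ^ 2 := by
            apply pow_le_pow_left₀ (by positivity)
            nlinarith
          linarith
        linarith
      · rw [indicator_of_notMem (by exact hx)]
        positivity
  have iJ : ∀ c ≥ 0, Integrable (J c) := fun c hc =>
    ibd.mono' (hJm c) (Eventually.of_forall fun x => by
      rw [Real.norm_of_nonneg (hJnn c x)]; exact hJbd c hc x)
  have hJlim : Tendsto (fun c => ∫ x, J c x) atTop (nhds 0) := by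
    have := tendsto_integral_filter_of_dominated_convergence (μ := volume) (l := atTop) (F := J) (f := fun _ => (0:ℝ)) bd
      (Eventually.of_forall hJm)
      ((eventually_ge_atTop 0).mono fun c hc => Eventually.of_forall fun x => by
        rw [Real.norm_of_nonneg (hJnn c x)]; exact hJbd c hc x) ibd ?_
    · simpa using this
    · refine Eventually.of_forall fun x => ?_
      have t1 : Tendsto (fun c => Kf (L * (x + c))) atTop (nhds 0) :=
        Kf_tendsto_zero _ ((tendsto_atTop_add_const_left _ x tendsto_id).const_mul_atTop hL)
      have t2 : Tendsto (fun c => Kf (L * (x - c))) atTop (nhds 0) := by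
        have : ∀ c, Kf (L * (x - c)) = Kf (L * (-x + c)) := fun c => by
          rw [← Kf_neg]; congr 1; ring
        simp only [this]
        exact Kf_tendsto_zero _ ((tendsto_atTop_add_const_left _ (-x) tendsto_id).const_mul_atTop hL)
      have t3 := ((t2.add t1).const_mul (L / 4)).const_mul (D1 x)
      have t4 : Tendsto (fun c => (Ici (0:ℝ)).indicator (fun x => M * (L / 4 * Kf (L * (x + c)))) x) atTop (nhds 0) := by
        by_cases hx : 0 ≤ x
        · simp only [indicator_of_mem (show x ∈ Ici (0:ℝ) from hx)]
          simpa using (t1.const_mul (L / 4)).const_mul M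
        · simp only [indicator_of_notMem (show x ∉ Ici (0:ℝ) from hx)]
          exact tendsto_const_nhds
      simpa using t3.add t4
  have htr : Tendsto (fun y : ℝ => y - h / 2) atTop atTop := tendsto_atTop_add_const_right _ (-(h/2)) tendsto_id
  have h1 : ∀ᶠ y in atTop, A - ε < QQ D L (y - h / 2) :=
    ((hQ L hLL).comp htr).eventually (lt_mem_nhds (by linarith))
  have h2 : ∀ᶠ y in atTop, ∫ x, J (y - h / 2) x < ε :=
    (hJlim.comp htr).eventually (gt_mem_nhds hε)
  filter_upwards [h1, h2, eventually_ge_atTop (x1 + h), eventually_ge_atTop (h/2)] with y hy1 hy2 hyx hyh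
  set c := y - h / 2 with hc
  have hc0 : 0 ≤ c := by linarith
  have hε2 : 0 < 1 - ε := by linarith
  set q := (D y + ε) / (1 - ε) with hq
  have hq0 : 0 ≤ q := div_nonneg (by have := hDnn y; linarith) hε2.le
  set k : ℝ → ℝ := fun x => L / 4 * Kf (L * (x - c)) with hk
  obtain ⟨ik, ek⟩ : Integrable k ∧ ∫ x, k x = (∫ z, Kf z) / 4 := Kf_tot L c hL
  have hk0 : ∀ x, 0 ≤ k x := fun x => by have := Kf_nonneg (L * (x - c)); simp only [hk]; positivity
  set I := Ioc (c - h/2) (c + h/2) with hI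
  have pw : ∀ x, D x * (L / 4 * (Kf (L * (x - c)) + Kf (L * (x + c)))) ≤
      q * k x + M * (k x - I.indicator k x) + J c x := by
    intro x
    have hk2 := Kf_nonneg (L * (x + c))
    have hkk : I.indicator k x ≤ k x := indicator_le_self' (fun x _ => hk0 x) x
    have hqk := mul_nonneg hq0 (hk0 x)
    have hMk := mul_nonneg hM0 (sub_nonneg.mpr hkk)
    by_cases hx : x < y0
    · have e1 : D1 x = D x := indicator_of_mem (by exact hx) _
      have e2 : 0 ≤ (Ici (0:ℝ)).indicator (fun x => M * (L / 4 * Kf (L * (x + c)))) x :=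
        indicator_nonneg (fun x _ => by have k2 := Kf_nonneg (L * (x + c)); positivity) x
      simp only [hJ, e1]
      linarith
    · push Not at hx
      have e1 : D1 x = 0 := indicator_of_notMem (by simpa using hx) _
      have hx0 : 0 ≤ x := by linarith
      simp only [hJ, e1, zero_mul, indicator_of_mem (show x ∈ Ici (0:ℝ) from hx0)]
      have hDM := hM x hx
      have p1 : D x * (L / 4 * Kf (L * (x + c))) ≤ M * (L / 4 * Kf (L * (x + c))) :=
        mul_le_mul_of_nonneg_right hDM (by positivity)
      have p2 : D x * k x ≤ q * k x + M * (k x - I.indicator k x) := by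
        by_cases hxI : x ∈ I
        · rw [indicator_of_mem hxI]
          have a1 := hxI.1
          have a2 := hxI.2
          rw [hc] at a1 a2
          have := hd x y (by linarith) (by linarith) (by linarith)
          have hDq : D x ≤ q := by
            rw [hq, le_div_iff₀ hε2]; linarith
          have := mul_le_mul_of_nonneg_right hDq (hk0 x)
          linarith
        · rw [indicator_of_notMem hxI]
          have := mul_le_mul_of_nonneg_right hDM (hk0 x)
          linarith
      simp only [hk] at p2 ⊢
      linarith
  have iI : Integrable (I.indicator k) := ik.indicator measurableSet_Ioc
  have b1 : QQ D L c ≤ ∫ x, (q * k x + M * (k x - I.indicator k x) + J c x) :=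
    integral_mono (hQi L hLL c) (((ik.const_mul q).add ((ik.sub iI).const_mul M)).add (iJ c hc0)) pw
  have eI : ∫ x, I.indicator k x = (∫ z in (-(L * (h/2)))..(L * (h/2)), Kf z) / 4 := by
    rw [integral_indicator measurableSet_Ioc, ← intervalIntegral.integral_of_le (by linarith)]
    exact Kf_win L c (h/2) hL
  have b2 : ∫ x, (q * k x + M * (k x - I.indicator k x) + J c x) =
      q * ((∫ z, Kf z) / 4) + M * ((∫ z, Kf z) / 4 - (∫ z in (-(L * (h/2)))..(L * (h/2)), Kf z) / 4) + ∫ x, J c x := by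
    have i1 : Integrable (fun x => q * k x) := ik.const_mul q
    have i2 : Integrable (fun x => M * (k x - I.indicator k x)) := (ik.sub iI).const_mul M
    have i3 : Integrable (fun x => q * k x + M * (k x - I.indicator k x)) := i1.add i2
    rw [integral_add i3 (iJ c hc0), integral_add i1 i2, integral_const_mul q k, integral_const_mul M,
      integral_sub ik iI, ek, eI]
  have b3 : M * ((∫ z, Kf z) / 4 - (∫ z in (-(L * (h/2)))..(L * (h/2)), Kf z) / 4) ≤ M * (ε * ((∫ z, Kf z) / 4)) := by
    apply mul_le_mul_of_nonneg_left _ hM0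
    linarith
  linarith

lemma tauber (D : ℝ → ℝ) (hD0 : ∀ x < 0, D x = 0) (hDnn : ∀ x, 0 ≤ D x)
    (hint : ∀ δ > 0, Integrable (fun x => Real.exp (-δ * x) * D x))
    (hdecr : ∀ ε, 0 < ε → ε < 1 → ∃ h > 0, ∃ x1, ∀ x y, x1 ≤ x → x ≤ y → y ≤ x + h → (1 - ε) * D x - ε ≤ D y)
    (A L0 : ℝ) (hQi : ∀ L ≥ L0, ∀ y, Integrable (fun x => D x * (L / 4 * (Kf (L * (x - y)) + Kf (L * (x + y))))))
    (hQ : ∀ L ≥ L0, Tendsto (QQ D L) atTop (nhds A)) :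
    Tendsto D atTop (nhds (A / ((∫ z, Kf z) / 4))) := by
  have hup := tauber_upper D hDnn hdecr A L0 hQi hQ
  set κ := (∫ z, Kf z) / 4 with hκ
  have hκ0 : 0 < κ := by have := Kf_pos; positivity
  have hup' : ∀ ε, 0 < ε → ε < 1 → ∀ᶠ y in atTop, D y ≤ ((A + ε) / ((1 - ε) * κ) + ε) / (1 - ε) := by
    intro ε h1 h2
    have h3 : 0 < 1 - ε := by linarith
    filter_upwards [hup ε h1 h2] with y hy
    rw [le_div_iff₀ h3, ← sub_le_iff_le_add, le_div_iff₀ (by positivity)]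
    rw [mul_div_assoc, ← hκ, mul_comm (1 - ε) (D y)] at hy
    linarith
  obtain ⟨M, y0, hy0, hM⟩ : ∃ M y0 : ℝ, 0 ≤ y0 ∧ ∀ x ≥ y0, D x ≤ M := by
    obtain ⟨y0, hy0⟩ := eventually_atTop.mp (hup' (1/2) (by norm_num) (by norm_num))
    exact ⟨_, max y0 0, le_max_right _ _, fun x hx => hy0 x ((le_max_left _ _).trans hx)⟩
  have hlo := tauber_lower D hD0 hDnn hint hdecr A L0 hQi hQ M y0 hy0 hM
  have hlo' : ∀ ε, 0 < ε → ε < 1 → ∀ᶠ y in atTop, (A - 2 * ε - M * (ε * κ)) / κ * (1 - ε) - ε ≤ D y := by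
    intro ε h1 h2
    have h3 : 0 < 1 - ε := by linarith
    filter_upwards [hlo ε h1 h2] with y hy
    rw [sub_le_iff_le_add, ← le_div_iff₀ h3, div_le_iff₀ hκ0]
    rw [← hκ] at hy
    linarith
  have hmem : Ioo (0:ℝ) 1 ∈ nhdsWithin (0:ℝ) (Ioi 0) := Ioo_mem_nhdsGT one_pos
  rw [tendsto_order]
  constructor
  · intro a ha
    have hc : Tendsto (fun ε : ℝ => (A - 2 * ε - M * (ε * κ)) / κ * (1 - ε) - ε) (nhdsWithin 0 (Ioi 0)) (nhds (A / κ)) := by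
      have : Continuous (fun ε : ℝ => (A - 2 * ε - M * (ε * κ)) / κ * (1 - ε) - ε) := by fun_prop
      have h := this.tendsto 0
      simp only [mul_zero, sub_zero, zero_mul, mul_one] at h
      exact h.mono_left nhdsWithin_le_nhds
    obtain ⟨ε, h1, h2⟩ := ((hc.eventually (lt_mem_nhds ha)).and hmem).exists
    filter_upwards [hlo' ε h2.1 h2.2] with y hy
    linarith
  · intro a ha
    have hc : Tendsto (fun ε : ℝ => ((A + ε) / ((1 - ε) * κ) + ε) / (1 - ε)) (nhdsWithin 0 (Ioi 0)) (nhds (A / κ)) := by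
      have : ContinuousAt (fun ε : ℝ => ((A + ε) / ((1 - ε) * κ) + ε) / (1 - ε)) 0 := by
        apply ContinuousAt.div _ (by fun_prop) (by norm_num)
        apply ContinuousAt.add _ (by fun_prop)
        apply ContinuousAt.div (by fun_prop) (by fun_prop)
        simpa using hκ0.ne'
      have h := this.tendsto
      simp only [add_zero, sub_zero, one_mul, div_one] at h
      exact h.mono_left nhdsWithin_le_nhds
    obtain ⟨ε, h1, h2⟩ := ((hc.eventually (gt_mem_nhds ha)).and hmem).exists
    filter_upwards [hup' ε h2.1 h2.2] with y hy
    linarith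

lemma slow_step (S : ℝ → ℝ) (ε x y : ℝ) (h : (S y - S x) / Real.exp x ≥ -ε) : S x - ε * Real.exp x ≤ S y := by
  rw [ge_iff_le, le_div_iff₀ (Real.exp_pos x)] at h
  linarith

lemma slow_lower (S : ℝ → ℝ) (hslow : LogLinSlowlyDecreasing S) :
    ∃ K x0 : ℝ, 0 ≤ K ∧ 0 < x0 ∧ ∀ x ≥ x0, 0 ≤ S x + K * Real.exp x := by
  obtain ⟨h, hh, x0, hx0, hs⟩ := hslow 1 one_pos
  have he : 1 < Real.exp h := Real.one_lt_exp_iff.mpr hh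
  have he' : 0 < Real.exp h - 1 := by linarith
  set K := |S x0| + 1 + 1 / (Real.exp h - 1) with hK
  have hK1 : 0 < 1 / (Real.exp h - 1) := by positivity
  have hKe : K + 1 ≤ K * Real.exp h := by
    have : 1 ≤ K * (Real.exp h - 1) := by
      rw [hK, add_mul, div_mul_cancel₀ _ he'.ne']
      have : 0 ≤ (|S x0| + 1) * (Real.exp h - 1) := by positivity
      linarith
    linarith
  have hK0 : 0 ≤ K := by positivity
  refine ⟨K, x0, hK0, hx0, ?_⟩
  have key : ∀ n : ℕ, ∀ x, x0 ≤ x → x ≤ x0 + (n + 1) * h → 0 ≤ S x + K * Real.exp x := by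
    intro n
    induction n with
    | zero =>
      intro x h1 h2
      have := slow_step S 1 x0 x (hs x0 x le_rfl h1 (by simpa using h2))
      have e1 : 1 ≤ Real.exp x0 := Real.one_le_exp hx0.le
      have e2 : Real.exp x0 ≤ Real.exp x := Real.exp_le_exp.mpr h1
      have e3 := neg_abs_le (S x0)
      have e4 : (|S x0| + 1) * Real.exp x0 ≤ K * Real.exp x :=
        mul_le_mul (by linarith) e2 (by positivity) hK0
      nlinarith [abs_nonneg (S x0)]
    | succ n ih =>
      intro x h1 h2
      by_cases hx : x ≤ x0 + (n + 1) * h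
      · exact ih x h1 hx
      · push Not at hx
        have hn : (0:ℝ) ≤ n := n.cast_nonneg
        have g1 : x0 ≤ x - h := by nlinarith
        have g2 : x - h ≤ x0 + (n + 1) * h := by push_cast at h2; linarith
        have := ih (x - h) g1 g2
        have s := slow_step S 1 (x - h) x (hs (x - h) x g1 (by linarith) (by linarith))
        have e : Real.exp x = Real.exp h * Real.exp (x - h) := by rw [← Real.exp_add]; ring_nf
        have e5 := mul_le_mul_of_nonneg_right hKe (Real.exp_pos (x - h)).le
        rw [e]
        nlinarith
  intro x hx
  obtain ⟨n, hn⟩ := exists_nat_ge ((x - x0) / h)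
  refine key n x hx ?_
  rw [div_le_iff₀ hh] at hn
  nlinarith

lemma abelian (e : ℝ → ℝ) (a : ℝ) (hint : ∀ δ > 0, IntegrableOn (fun x => Real.exp (-δ * x) * e x) (Ioi 0))
    (he : Tendsto e atTop (nhds a)) :
    Tendsto (fun δ => δ * ∫ x in Ioi (0:ℝ), Real.exp (-δ * x) * e x) (nhdsWithin 0 (Ioi 0)) (nhds a) := by
  have iexp : ∀ δ > 0, IntegrableOn (fun x : ℝ => Real.exp (-δ * x)) (Ioi 0) := fun δ hδ =>
    integrableOn_exp_mul_Ioi (by linarith) 0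
  have vexp : ∀ δ > 0, ∫ x in Ioi (0:ℝ), Real.exp (-δ * x) = 1 / δ := fun δ hδ => by
    rw [integral_exp_mul_Ioi (by linarith)]; simp
  have iw : ∀ δ > 0, IntegrableOn (fun x => Real.exp (-δ * x) * (e x - a)) (Ioi 0) := fun δ hδ => by
    refine ((hint δ hδ).sub ((iexp δ hδ).mul_const a)).congr (Eventually.of_forall fun x => ?_)
    simp only [Pi.sub_apply]; ring
  rw [Metric.tendsto_nhds]
  intro ε hε
  obtain ⟨X, hX⟩ := eventually_atTop.mp ((Metric.tendsto_nhds.mp he) (ε/2) (by positivity))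
  set I := Ioc (0:ℝ) X
  set c : ℝ → ℝ := I.indicator (fun x => |e x - a|) with hc
  have ic : IntegrableOn c (Ioi 0) := by
    apply Integrable.integrableOn
    rw [hc, integrable_indicator_iff measurableSet_Ioc]
    have h1 : IntegrableOn (fun x => Real.exp (-1 * x) * (e x - a)) I := (iw 1 one_pos).mono_set Ioc_subset_Ioi_self
    have h2 := (h1.continuousOn_mul_of_subset (K := Icc 0 X) (g := fun x => Real.exp x) (by fun_prop)
      isCompact_Icc measurableSet_Ioc Ioc_subset_Icc_self)
    refine (Integrable.abs h2).congr (Eventually.of_forall fun x => ?_)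
    simp only []
    rw [← mul_assoc, ← Real.exp_add]
    simp
  set Cc := ∫ x in Ioi (0:ℝ), c x with hCc
  have hsm : ∀ᶠ δ in nhdsWithin (0:ℝ) (Ioi 0), δ * Cc < ε / 2 := by
    have : Tendsto (fun δ : ℝ => δ * Cc) (nhdsWithin 0 (Ioi 0)) (nhds (0 * Cc)) :=
      (Continuous.tendsto (by fun_prop) 0).mono_left nhdsWithin_le_nhds
    rw [zero_mul] at this
    exact this.eventually (gt_mem_nhds (by positivity))
  filter_upwards [hsm, self_mem_nhdsWithin] with δ h1 hδ
  have hδ : 0 < δ := hδ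
  have e1 : δ * (∫ x in Ioi (0:ℝ), Real.exp (-δ * x) * e x) - a = δ * ∫ x in Ioi (0:ℝ), Real.exp (-δ * x) * (e x - a) := by
    have : ∫ x in Ioi (0:ℝ), Real.exp (-δ * x) * (e x - a) =
        (∫ x in Ioi (0:ℝ), Real.exp (-δ * x) * e x) - ∫ x in Ioi (0:ℝ), Real.exp (-δ * x) * a := by
      rw [← integral_sub (hint δ hδ) ((iexp δ hδ).mul_const a)]
      congr 1; funext x; ring
    rw [this, integral_mul_const, vexp δ hδ]
    field_simp
  rw [Real.dist_eq, e1, abs_mul, abs_of_pos hδ]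
  have e2 : |∫ x in Ioi (0:ℝ), Real.exp (-δ * x) * (e x - a)| ≤ ∫ x in Ioi (0:ℝ), (c x + ε / 2 * Real.exp (-δ * x)) := by
    rw [← Real.norm_eq_abs]
    apply norm_integral_le_of_norm_le (ic.add ((iexp δ hδ).const_mul _))
    filter_upwards [ae_restrict_mem measurableSet_Ioi] with x hx
    have hx : 0 < x := hx
    rw [norm_mul, Real.norm_eq_abs, Real.norm_eq_abs, Real.abs_exp]
    have hp := Real.exp_pos (-δ * x)
    change _ ≤ c x + ε / 2 * Real.exp (-δ * x)
    by_cases hxX : x ≤ X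
    · have : c x = |e x - a| := indicator_of_mem (show x ∈ I from ⟨hx, hxX⟩) _
      rw [this]
      have h3 : Real.exp (-δ * x) ≤ 1 := Real.exp_le_one_iff.mpr (by nlinarith)
      nlinarith [abs_nonneg (e x - a)]
    · have : c x = 0 := indicator_of_notMem (fun h => hxX h.2) _
      rw [this]
      have := (hX x (by linarith)).le
      rw [Real.dist_eq] at this
      nlinarith
  rw [integral_add ic ((iexp δ hδ).const_mul _), integral_const_mul, vexp δ hδ, ← hCc] at e2
  calc _ ≤ δ * (Cc + ε / 2 * (1 / δ)) := mul_le_mul_of_nonneg_left e2 hδ.le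
    _ = δ * Cc + ε / 2 := by field_simp
    _ < ε := by linarith

lemma exp_cos_int (δ t : ℝ) (hδ : 0 < δ) :
    IntegrableOn (fun x => Real.exp (-δ * x) * Real.cos (t * x)) (Ioi 0) ∧
    ∫ x in Ioi (0:ℝ), Real.exp (-δ * x) * Real.cos (t * x) = δ / (δ ^ 2 + t ^ 2) := by
  set a : ℂ := -δ + t * Complex.I with ha
  have hre : a.re < 0 := by simp [ha, hδ]
  have hi := integrableOn_exp_mul_complex_Ioi hre 0
  have hv := integral_exp_mul_complex_Ioi hre 0
  have e : ∀ x : ℝ, (Complex.exp (a * x)).re = Real.exp (-δ * x) * Real.cos (t * x) := by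
    intro x
    rw [Complex.exp_re]
    simp [ha]
  constructor
  · refine (Integrable.re hi).congr (Eventually.of_forall fun x => ?_)
    exact e x
  · have h2 := integral_re hi
    simp only [RCLike.re_to_complex, e] at h2
    rw [h2, hv]
    simp [ha, Complex.div_re, Complex.normSq_apply]
    ring

lemma laplace_re (S : ℝ → ℝ) (hconv : ∀ s : ℂ, 1 < s.re →
      IntegrableOn (fun x : ℝ => Complex.exp (-s * x) * (S x : ℂ)) (Ioi 0)) (δ t : ℝ) (hδ : 0 < δ) :
    IntegrableOn (fun x => Real.exp (-δ * x) * Real.cos (t * x) * (Real.exp (-x) * S x)) (Ioi 0) ∧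
    (laplaceT S (((1 + δ : ℝ) : ℂ) + t * Complex.I)).re =
      ∫ x in Ioi (0:ℝ), Real.exp (-δ * x) * Real.cos (t * x) * (Real.exp (-x) * S x) := by
  have hi := hconv (((1 + δ : ℝ) : ℂ) + t * Complex.I) (by simp [hδ])
  have e : ∀ x : ℝ, (Complex.exp (-(((1 + δ : ℝ) : ℂ) + t * Complex.I) * x) * (S x : ℂ)).re =
      Real.exp (-δ * x) * Real.cos (t * x) * (Real.exp (-x) * S x) := by
    intro x
    rw [Complex.re_mul_ofReal, Complex.exp_re]
    have h1 : (-(((1 + δ : ℝ) : ℂ) + t * Complex.I) * x).re = -δ * x + -x := by simp; ring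
    have h2 : (-(((1 + δ : ℝ) : ℂ) + t * Complex.I) * x).im = -(t * x) := by simp
    rw [h1, h2, Real.exp_add, Real.cos_neg]
    ring
  constructor
  · refine (Integrable.re hi).congr (Eventually.of_forall fun x => ?_)
    exact e x
  · have h2 := integral_re hi
    simp only [RCLike.re_to_complex, e] at h2
    rw [h2, laplaceT]

noncomputable def RR (d : ℝ → ℝ) (X0 δ t : ℝ) : ℝ :=
  ∫ x in Ioc 0 X0, Real.exp (-|δ| * x) * Real.cos (t * x) * d x

lemma RR_pt (d : ℝ → ℝ) (δ t x : ℝ) (hx : 0 < x) :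
    ‖Real.exp (-|δ| * x) * Real.cos (t * x) * d x‖ ≤ |d x| := by
  rw [norm_mul, norm_mul, Real.norm_eq_abs, Real.norm_eq_abs, Real.norm_eq_abs, Real.abs_exp]
  have h1 : Real.exp (-|δ| * x) ≤ 1 := Real.exp_le_one_iff.mpr (by nlinarith [abs_nonneg δ])
  have h2 := Real.abs_cos_le_one (t * x)
  have h3 : Real.exp (-|δ| * x) * |Real.cos (t * x)| ≤ 1 := mul_le_one₀ h1 (abs_nonneg _) h2
  calc _ ≤ 1 * |d x| := mul_le_mul_of_nonneg_right h3 (abs_nonneg _)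
    _ = _ := one_mul _

lemma RR_cont (d : ℝ → ℝ) (X0 : ℝ) (hd : IntegrableOn d (Ioc 0 X0)) :
    Continuous (fun p : ℝ × ℝ => RR d X0 p.1 p.2) := by
  unfold RR
  refine continuous_of_dominated (bound := fun x => |d x|) ?_ ?_ hd.abs ?_
  · intro p
    exact (Continuous.aestronglyMeasurable (by fun_prop)).mul hd.aestronglyMeasurable
  · intro p
    filter_upwards [ae_restrict_mem measurableSet_Ioc] with x hx
    exact RR_pt d _ _ x hx.1
  · refine Eventually.of_forall fun x => ?_
    fun_prop

lemma RR_bound (d : ℝ → ℝ) (X0 : ℝ) (hd : IntegrableOn d (Ioc 0 X0)) (δ t : ℝ) :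
    |RR d X0 δ t| ≤ ∫ x in Ioc 0 X0, |d x| := by
  unfold RR
  rw [← Real.norm_eq_abs]
  apply norm_integral_le_of_norm_le hd.abs
  filter_upwards [ae_restrict_mem measurableSet_Ioc] with x hx
  exact RR_pt d _ _ x hx.1

lemma VV_split (d : ℝ → ℝ) (X0 : ℝ) (hX0 : 0 < X0) (δ t : ℝ) (hδ : 0 < δ)
    (hi : IntegrableOn (fun x => Real.exp (-δ * x) * Real.cos (t * x) * d x) (Ioi 0)) :
    VV ((Ici X0).indicator d) δ t =
      (∫ x in Ioi (0:ℝ), Real.exp (-δ * x) * Real.cos (t * x) * d x) - RR d X0 δ t := by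
  have e1 : VV ((Ici X0).indicator d) δ t =
      ∫ x in Ioi X0, Real.exp (-δ * x) * Real.cos (t * x) * d x := by
    rw [VV, ← integral_Ici_eq_integral_Ioi, ← integral_indicator measurableSet_Ici]
    congr 1; funext x
    by_cases hx : x ∈ Ici X0 <;> simp [hx]
  have e2 : RR d X0 δ t = ∫ x in Ioc 0 X0, Real.exp (-δ * x) * Real.cos (t * x) * d x := by
    rw [RR, abs_of_pos hδ]
  rw [e1, e2, ← Ioc_union_Ioi_eq_Ioi hX0.le, setIntegral_union (Ioc_disjoint_Ioi le_rfl) measurableSet_Ioi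
    (hi.mono_set Ioc_subset_Ioi_self) (hi.mono_set (Ioi_subset_Ioi hX0.le))]
  ring

/-- continuity of the real part of the transform in the abscissa -/
lemma trans_cont (e : ℝ → ℝ) (hint : ∀ δ > 0, IntegrableOn (fun x => Real.exp (-δ * x) * e x) (Ioi 0)) (t : ℝ) :
    ContinuousOn (fun δ => ∫ x in Ioi (0:ℝ), Real.exp (-δ * x) * Real.cos (t * x) * e x) (Ioi 0) := by
  intro δ0 hδ0
  have hδ0 : 0 < δ0 := hδ0
  apply ContinuousAt.continuousWithinAt
  have hnear : ∀ᶠ δ in nhds δ0, δ0 / 2 < δ := lt_mem_nhds (by linarith)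
  refine continuousAt_of_dominated (bound := fun x => |Real.exp (-(δ0/2) * x) * e x|) ?_ ?_
    (hint (δ0/2) (by linarith)).abs ?_
  · filter_upwards [hnear] with δ hδ
    refine AEStronglyMeasurable.congr ((Continuous.aestronglyMeasurable (f := fun x : ℝ => Real.cos (t * x)) (by fun_prop)).mul
      (hint δ (by linarith)).aestronglyMeasurable) (Eventually.of_forall fun x => ?_)
    simp only [Pi.mul_apply]; ring
  · filter_upwards [hnear] with δ hδ
    filter_upwards [ae_restrict_mem measurableSet_Ioi] with x hx
    have hx : 0 < x := hx
    rw [norm_mul, norm_mul, Real.norm_eq_abs, Real.norm_eq_abs, Real.norm_eq_abs, Real.abs_exp, abs_mul, Real.abs_exp]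
    have h1 : Real.exp (-δ * x) ≤ Real.exp (-(δ0/2) * x) := Real.exp_le_exp.mpr (by nlinarith)
    have h3 : Real.exp (-δ * x) * |Real.cos (t * x)| ≤ Real.exp (-(δ0/2) * x) * 1 :=
      mul_le_mul h1 (Real.abs_cos_le_one _) (abs_nonneg _) (Real.exp_pos _).le
    rw [mul_one] at h3
    exact mul_le_mul_of_nonneg_right h3 (abs_nonneg _)
  · refine Eventually.of_forall fun x => ?_
    fun_prop

lemma choose_T (W : ℝ → ℝ → ℝ) (lam : ℝ) (hlam : 0 < lam) (g : ℝ → ℝ)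
    (hW : ∀ t, ContinuousOn (fun δ => W δ t) (Ioi 0))
    (hlow : ∀ δ ∈ Ioc (0:ℝ) 1, ∀ᵐ t ∂(volume.restrict (Ioo (-lam) lam)), g t ≤ W δ t) :
    ∃ T, 0 < T ∧ T < lam ∧ ∀ δ ∈ Ioc (0:ℝ) 1, g T ≤ W δ T := by
  have h1 : ∀ᵐ t ∂(volume.restrict (Ioo 0 lam)), ∀ q : ℚ, (q:ℝ) ∈ Ioc (0:ℝ) 1 → g t ≤ W q t := by
    rw [ae_all_iff]
    intro q
    by_cases hq : (q:ℝ) ∈ Ioc (0:ℝ) 1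
    · filter_upwards [ae_restrict_of_ae_restrict_of_subset (Ioo_subset_Ioo_left (by linarith)) (hlow q hq)] with t ht
      exact fun _ => ht
    · exact Eventually.of_forall fun t h => absurd h hq
  have h2 : (ae (volume.restrict (Ioo 0 lam))).NeBot := by
    rw [ae_neBot]
    intro h
    rw [Measure.restrict_eq_zero, Real.volume_Ioo] at h
    simp at h
    linarith
  obtain ⟨T, hT1, hT2⟩ := (h1.and (ae_restrict_mem measurableSet_Ioo)).exists
  refine ⟨T, hT2.1, hT2.2, fun δ hδ => ?_⟩
  -- approximate from below by rationals
  have hc : ContinuousWithinAt (fun δ => W δ T) (Ioo 0 δ) δ :=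
    ((hW T) δ hδ.1).mono Ioo_subset_Ioi_self
  by_contra hlt
  push Not at hlt
  have hev := hc.eventually (gt_mem_nhds hlt)
  have hc2 : ∀ᶠ x in nhds δ, x ∈ Ioo 0 δ → W x T < g T := by
    have := mem_nhdsWithin_iff_eventually.mp hev
    exact this
  obtain ⟨r, hr, hball⟩ := Metric.eventually_nhds_iff.mp hc2
  obtain ⟨q, hq1, hq2⟩ := exists_rat_btwn (show max 0 (δ - r) < δ from max_lt hδ.1 (by linarith))
  have hq0 : (0:ℝ) < q := lt_of_le_of_lt (le_max_left _ _) hq1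
  have hqr : δ - r < q := lt_of_le_of_lt (le_max_right _ _) hq1
  have a1 := hball (y := q) (by rw [Real.dist_eq, abs_lt]; constructor <;> linarith) ⟨hq0, hq2⟩
  have a2 := hT1 q ⟨hq0, by linarith [hδ.2]⟩
  linarith

lemma trans_cont_t (e : ℝ → ℝ) (hint : ∀ δ > 0, IntegrableOn (fun x => Real.exp (-δ * x) * e x) (Ioi 0))
    (δ : ℝ) (hδ : 0 < δ) :
    Continuous (fun t => ∫ x in Ioi (0:ℝ), Real.exp (-δ * x) * Real.cos (t * x) * e x) := by
  refine continuous_of_dominated (bound := fun x => |Real.exp (-δ * x) * e x|) ?_ ?_ (hint δ hδ).abs ?_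
  · intro t
    refine AEStronglyMeasurable.congr ((Continuous.aestronglyMeasurable (f := fun x : ℝ => Real.cos (t * x)) (by fun_prop)).mul
      (hint δ hδ).aestronglyMeasurable) (Eventually.of_forall fun x => ?_)
    simp only [Pi.mul_apply]; ring
  · intro t
    refine Eventually.of_forall fun x => ?_
    rw [norm_mul, norm_mul, Real.norm_eq_abs, Real.norm_eq_abs, Real.norm_eq_abs, Real.abs_exp, abs_mul, Real.abs_exp]
    have h3 : Real.exp (-δ * x) * |Real.cos (t * x)| ≤ Real.exp (-δ * x) * 1 :=
      mul_le_mul_of_nonneg_left (Real.abs_cos_le_one _) (Real.exp_pos _).le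
    rw [mul_one] at h3
    exact mul_le_mul_of_nonneg_right h3 (abs_nonneg _)
  · refine Eventually.of_forall fun x => ?_
    fun_prop

lemma rest_tendsto (d : ℝ → ℝ) (X0 K r L : ℝ) (hK : 0 ≤ K) (hd : IntegrableOn d (Ioc 0 X0)) (hr : 0 < r) (hrL : r ≤ L) :
    Tendsto (fun δ => ∫ t in r..L, |K * (δ / (δ ^ 2 + t ^ 2)) - (RR d X0 δ t - RR d X0 0 t)|)
      (nhdsWithin 0 (Ioi 0)) (nhds 0) := by
  have hc := RR_cont d X0 hd
  have hc2 : ∀ δ, Continuous (fun t => RR d X0 δ t) := fun δ => hc.comp (by fun_prop : Continuous fun t : ℝ => (δ, t))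
  have hc1 : ∀ t, Continuous (fun δ => RR d X0 δ t) := fun t => hc.comp (by fun_prop : Continuous fun δ : ℝ => (δ, t))
  have hz : (0:ℝ) = ∫ t in r..L, (0:ℝ) := by simp
  suffices hgoal : Tendsto (fun δ => ∫ t in r..L, |K * (δ / (δ ^ 2 + t ^ 2)) - (RR d X0 δ t - RR d X0 0 t)|)
      (nhdsWithin 0 (Ioi 0)) (nhds (∫ t in r..L, (0:ℝ))) by
    rwa [← hz] at hgoal
  refine intervalIntegral.tendsto_integral_filter_of_dominated_convergence
    (fun _ => K * (1 / r ^ 2) + ((∫ x in Ioc 0 X0, |d x|) + ∫ x in Ioc 0 X0, |d x|)) ?_ ?_ ?_ ?_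
  · filter_upwards [self_mem_nhdsWithin] with δ hδ
    have hδ : 0 < δ := hδ
    have h1 : Continuous (fun t : ℝ => δ / (δ ^ 2 + t ^ 2)) :=
      continuous_const.div (by fun_prop) (fun t => by positivity)
    have h2 := hc2 δ
    have h3 := hc2 0
    exact Continuous.aestronglyMeasurable (by fun_prop)
  · filter_upwards [Ioc_mem_nhdsGT (zero_lt_one' ℝ)] with δ hδ
    refine Eventually.of_forall fun t ht => ?_
    rw [uIoc_of_le hrL] at ht
    have h1 : δ / (δ ^ 2 + t ^ 2) ≤ 1 / r ^ 2 := by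
      have := hδ.1
      apply div_le_div₀ (by norm_num) hδ.2 (by positivity)
      nlinarith [ht.1, sq_nonneg δ]
    have h0 : 0 ≤ δ / (δ ^ 2 + t ^ 2) := div_nonneg hδ.1.le (by positivity)
    rw [Real.norm_eq_abs, abs_abs]
    have b1 := RR_bound d X0 hd δ t
    have b2 := RR_bound d X0 hd 0 t
    refine (abs_sub _ _).trans (add_le_add ?_ ((abs_sub _ _).trans (add_le_add b1 b2)))
    rw [abs_of_nonneg (mul_nonneg hK h0)]
    exact mul_le_mul_of_nonneg_left h1 hK
  · exact intervalIntegrable_const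
  · refine Eventually.of_forall fun t ht => ?_
    rw [uIoc_of_le hrL] at ht
    have ht0 : 0 < t := hr.trans ht.1
    have hcont : ContinuousAt (fun δ : ℝ => |K * (δ / (δ ^ 2 + t ^ 2)) - (RR d X0 δ t - RR d X0 0 t)|) 0 := by
      have h1 : ContinuousAt (fun δ : ℝ => δ / (δ ^ 2 + t ^ 2)) 0 :=
        ContinuousAt.div (by fun_prop) (by fun_prop) (by positivity)
      have h2 := (hc1 t).continuousAt (x := 0)
      fun_prop
    have := hcont.tendsto.mono_left (nhdsWithin_le_nhds (s := Ioi 0))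
    simpa using this

theorem wiener_ikehara_ultra (S : ℝ → ℝ)
    (hS : LocallyIntegrableOn S (Ici 0))
    (hslow : LogLinSlowlyDecreasing S)
    (hconv : ∀ s : ℂ, 1 < s.re →
      IntegrableOn (fun x : ℝ => Complex.exp (-s * x) * (S x : ℂ)) (Ioi 0))
    (U : ℂ → ℝ) (hU : ∀ s : ℂ, U s = (laplaceT S s).re)
    (hbd : L1locBoundaryBehavior U)
    (lam : ℝ) (hlam : 0 < lam)
    (g : ℝ → ℝ) (hg : IntegrableOn g (Ioo (-lam) lam))
    (η : ℝ → ℝ) (hη_mono : MonotoneOn η (Ici 0))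
    (hη_ge : ∀ x ∈ Ici (0 : ℝ), 1 ≤ η x)
    (hη_int : IntegrableOn (fun x : ℝ => Real.log (η x) / x ^ 2) (Ioi 1))
    (C : ℝ) (hC : 0 < C)
    (hlow : ∀ σ ∈ Ioc (1 : ℝ) 2, ∀ᵐ t ∂(volume.restrict (Ioo (-lam) lam)),
      g t ≤ U (σ + t * Complex.I))
    (hgrow : ∀ t ∈ Ioo (-lam) lam, ∀ σ ∈ Ioc (1 : ℝ) 2,
      |U (σ + t * Complex.I)| ≤ C * Real.exp (η (1 / (σ - 1)))) :
    ∃ a : ℝ,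
      Tendsto (fun σ : ℝ => (σ - 1) * U σ) (nhdsWithin 1 (Ioi 1)) (nhds a) ∧
      Tendsto (fun x : ℝ => Real.exp (-x) * S x) atTop (nhds a) := by
  obtain ⟨K, x0, hK, hx0, hKS⟩ := slow_lower S hslow
  obtain ⟨f, hf⟩ := hbd
  set e : ℝ → ℝ := fun x => Real.exp (-x) * S x with he
  have hinte : ∀ δ > 0, IntegrableOn (fun x => Real.exp (-δ * x) * e x) (Ioi 0) := by
    intro δ hδ
    have := (laplace_re S hconv δ 0 hδ).1
    simpa using this
  set W : ℝ → ℝ → ℝ := fun δ t => ∫ x in Ioi (0:ℝ), Real.exp (-δ * x) * Real.cos (t * x) * e x with hW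
  have hUW : ∀ δ t : ℝ, 0 < δ → U (((1 + δ : ℝ) : ℂ) + t * Complex.I) = W δ t := fun δ t hδ => by
    rw [hU, (laplace_re S hconv δ t hδ).2]
  have hlow2 : ∀ δ ∈ Ioc (0:ℝ) 1, ∀ᵐ t ∂(volume.restrict (Ioo (-lam) lam)), g t ≤ W δ t := by
    intro δ hδ
    filter_upwards [hlow (1 + δ) ⟨by linarith [hδ.1], by linarith [hδ.2]⟩] with t ht
    rwa [hUW δ t hδ.1] at ht
  obtain ⟨T, hT, hTl, hgT⟩ := choose_T W lam hlam g (trans_cont e hinte) hlow2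
  set b := Real.pi / 2 / T with hb
  have hb0 : 0 < b := by positivity
  have hbT : b * T = Real.pi / 2 := by rw [hb]; field_simp
  set X0 := max x0 (b + 1) with hX0d
  have hX0 : 0 < X0 := lt_of_lt_of_le hx0 (le_max_left _ _)
  have hbX : b < X0 := lt_of_lt_of_le (by linarith) (le_max_right x0 (b + 1))
  set d : ℝ → ℝ := fun x => e x + K with hd
  set D : ℝ → ℝ := (Ici X0).indicator d with hD
  have hDlt : ∀ x < X0, D x = 0 := fun x hx => indicator_of_notMem (by simpa using hx) _
  have hDge : ∀ x, X0 ≤ x → D x = e x + K := fun x hx => indicator_of_mem (show x ∈ Ici X0 from hx) _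
  have hdnn : ∀ x, x0 ≤ x → 0 ≤ d x := fun x hx => by
    have h1 := hKS x hx
    have h2 : d x = Real.exp (-x) * (S x + K * Real.exp x) := by
      have : Real.exp (-x) * Real.exp x = 1 := by rw [← Real.exp_add]; simp
      simp only [hd, he]
      linear_combination (-K) * this
    rw [h2]; positivity
  have hDnn : ∀ x, 0 ≤ D x := fun x => by
    by_cases hx : X0 ≤ x
    · rw [hDge x hx]; exact hdnn x ((le_max_left _ _).trans hx)
    · rw [hDlt x (not_le.mp hx)]
  have iexp : ∀ δ > 0, IntegrableOn (fun x : ℝ => Real.exp (-δ * x)) (Ioi 0) := fun δ hδ =>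
    integrableOn_exp_mul_Ioi (by linarith) 0
  have hintd : ∀ δ > 0, IntegrableOn (fun x => Real.exp (-δ * x) * d x) (Ioi 0) := by
    intro δ hδ
    refine ((hinte δ hδ).add ((iexp δ hδ).mul_const K)).congr (Eventually.of_forall fun x => ?_)
    simp only [Pi.add_apply, hd]; ring
  have hint : ∀ δ > 0, Integrable (fun x => Real.exp (-δ * x) * D x) := by
    intro δ hδ
    have h1 : (fun x => Real.exp (-δ * x) * D x) = (Ici X0).indicator (fun x => Real.exp (-δ * x) * d x) := by
      funext x
      by_cases hx : x ∈ Ici X0 <;> simp [hD, hx]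
    rw [h1, integrable_indicator_iff measurableSet_Ici]
    exact (hintd δ hδ).mono_set (fun x hx => lt_of_lt_of_le hX0 hx)
  have hdloc : IntegrableOn d (Ioc 0 X0) := by
    have h1 : IntegrableOn (fun x => Real.exp (-1 * x) * d x) (Ioc 0 X0) :=
      (hintd 1 one_pos).mono_set Ioc_subset_Ioi_self
    have h2 := (h1.continuousOn_mul_of_subset (K := Icc 0 X0) (g := fun x => Real.exp x) (by fun_prop)
      isCompact_Icc measurableSet_Ioc Ioc_subset_Icc_self)
    refine Integrable.congr h2 (Eventually.of_forall fun x => ?_)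
    simp only []
    rw [← mul_assoc, ← Real.exp_add]
    simp
  have hVV : ∀ δ t : ℝ, 0 < δ → VV D δ t = W δ t + K * (δ / (δ ^ 2 + t ^ 2)) - RR d X0 δ t := by
    intro δ t hδ
    obtain ⟨c1, c2⟩ := exp_cos_int δ t hδ
    have c3 := (laplace_re S hconv δ t hδ).1
    have c4 : (fun x => Real.exp (-δ * x) * Real.cos (t * x) * d x) = fun x =>
        Real.exp (-δ * x) * Real.cos (t * x) * (Real.exp (-x) * S x) + Real.exp (-δ * x) * Real.cos (t * x) * K := by
      funext x; simp only [hd, he]; ring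
    rw [hD, VV_split d X0 hX0 δ t hδ (by rw [c4]; exact c3.add (c1.mul_const K)), c4,
      integral_add c3 (c1.mul_const K), integral_mul_const, c2]
    simp only [hW, he]
    ring
  set B := ∫ x in Ioc 0 X0, |d x| with hB
  have hB0 : 0 ≤ B := integral_nonneg fun x => abs_nonneg _
  have hRB : ∀ δ t, |RR d X0 δ t| ≤ B := RR_bound d X0 hdloc
  have hVlow : ∀ δ t : ℝ, 0 < δ → g t ≤ W δ t → -(|g t| + B) ≤ VV D δ t := by
    intro δ t hδ h
    rw [hVV δ t hδ]
    have h1 := (abs_le.mp (hRB δ t)).2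
    have h2 := neg_abs_le (g t)
    have h3 : 0 ≤ K * (δ / (δ ^ 2 + t ^ 2)) := mul_nonneg hK (div_nonneg hδ.le (by positivity))
    linarith
  have hsub : Ioc 0 T ⊆ Ioo (-lam) lam := fun t ht => ⟨by linarith [ht.1], by linarith [ht.2]⟩
  obtain ⟨A, hA⟩ := core_Q D X0 hDlt hDnn hint T b hT hb0 hbT hbX (|g T| + B)
    (fun δ hδ => hVlow δ T hδ.1 (hgT δ hδ))
    (fun t => |g t| + B) ((hg.mono_set hsub).abs.add (integrableOn_const (by simp)))
    (fun t => by positivity)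
    (fun δ hδ => by
      filter_upwards [ae_restrict_of_ae_restrict_of_subset hsub (hlow2 δ hδ)] with t ht
      exact hVlow δ t hδ.1 ht)
    (fun t => f t - RR d X0 0 t)
    (fun r L hr hrL => by
      obtain ⟨f1, f2⟩ := hf r L hrL (fun h => by linarith [h.1])
      have f1' := f1.mono_set (Ioc_subset_Icc_self)
      have hRc : ∀ δ, Continuous (fun t => RR d X0 δ t) := fun δ =>
        (RR_cont d X0 hdloc).comp (by fun_prop : Continuous fun t : ℝ => (δ, t))
      refine ⟨f1'.sub ((hRc 0).integrableOn_Ioc), ?_⟩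
      have tl : Tendsto (fun δ : ℝ => 1 + δ) (nhdsWithin 0 (Ioi 0)) (nhdsWithin 1 (Ioi 1)) := by
        apply tendsto_nhdsWithin_of_tendsto_nhds_of_eventually_within
        · have : Tendsto (fun δ : ℝ => 1 + δ) (nhds 0) (nhds (1 + 0)) := Continuous.tendsto (by fun_prop) 0
          rw [add_zero] at this
          exact this.mono_left nhdsWithin_le_nhds
        · filter_upwards [self_mem_nhdsWithin] with δ hδ
          have : 0 < δ := hδ
          show 1 < 1 + δ
          linarith
      have t1 := (f2.comp tl).add (rest_tendsto d X0 K r L hK hdloc hr hrL)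
      rw [add_zero] at t1
      refine squeeze_zero' (Eventually.of_forall fun δ => intervalIntegral.integral_nonneg hrL fun t _ => abs_nonneg _) ?_ t1
      filter_upwards [self_mem_nhdsWithin] with δ hδ
      have hδ : 0 < δ := hδ
      simp only [Function.comp_apply, hUW δ _ hδ]
      have i1 : IntervalIntegrable (fun t => W δ t - f t) volume r L :=
        ((trans_cont_t e hinte δ hδ).intervalIntegrable r L).sub
          ((intervalIntegrable_iff_integrableOn_Ioc_of_le hrL).mpr f1')
      have i2 : IntervalIntegrable (fun t => K * (δ / (δ ^ 2 + t ^ 2)) - (RR d X0 δ t - RR d X0 0 t)) volume r L := by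
        have h1 : Continuous (fun t : ℝ => δ / (δ ^ 2 + t ^ 2)) :=
          continuous_const.div (by fun_prop) (fun t => by positivity)
        have h2 := hRc δ
        have h3 := hRc 0
        exact Continuous.intervalIntegrable (by fun_prop) _ _
      rw [← intervalIntegral.integral_add i1.abs i2.abs]
      have heq : ∀ t, VV D δ t - (f t - RR d X0 0 t) =
          (W δ t - f t) + (K * (δ / (δ ^ 2 + t ^ 2)) - (RR d X0 δ t - RR d X0 0 t)) := fun t => by
        rw [hVV δ t hδ]; ring
      simp only [heq]
      exact intervalIntegral.integral_mono_on hrL (i1.add i2).abs (i1.abs.add i2.abs) fun t _ => abs_add_le _ _)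
  have hdecr : ∀ ε : ℝ, 0 < ε → ε < 1 → ∃ h > 0, ∃ x1 : ℝ, ∀ x y, x1 ≤ x → x ≤ y → y ≤ x + h →
      (1 - ε) * D x - ε ≤ D y := by
    intro ε hε hε1
    obtain ⟨h', hh', x0', hx0', hs⟩ := hslow ε hε
    refine ⟨min h' ε, lt_min hh' hε, max x0' X0, fun x y hx hxy hy => ?_⟩
    have hxX : X0 ≤ x := (le_max_right _ _).trans hx
    have s := slow_step S ε x y (hs x y ((le_max_left _ _).trans hx) hxy
      (hy.trans (by linarith [min_le_left h' ε])))
    have hyx : y - x ≤ ε := by linarith [min_le_right h' ε]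
    have hDx := hDnn x
    rw [hDge x hxX] at hDx ⊢
    rw [hDge y (hxX.trans hxy)]
    have q1 : 1 - ε ≤ Real.exp (x - y) := by linarith [Real.add_one_le_exp (x - y)]
    have q2 : Real.exp (x - y) ≤ 1 := Real.exp_le_one_iff.mpr (by linarith)
    have q3 : Real.exp (-y) = Real.exp (x - y) * Real.exp (-x) := by rw [← Real.exp_add]; ring_nf
    have q4 : Real.exp (-y) * Real.exp x = Real.exp (x - y) := by rw [← Real.exp_add]; ring_nf
    have q5 := mul_le_mul_of_nonneg_left s (Real.exp_pos (-y)).le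
    have q6 : Real.exp (x - y) * e x - ε * Real.exp (x - y) ≤ e y := by
      have : Real.exp (-y) * (S x - ε * Real.exp x) = Real.exp (x - y) * e x - ε * Real.exp (x - y) := by
        simp only [he]
        linear_combination S x * q3 - ε * q4
      rw [← this]; exact q5
    have q7 := mul_le_mul_of_nonneg_right q1 hDx
    nlinarith
  have hlim := tauber D (fun x hx => hDlt x (hx.trans hX0)) hDnn hint hdecr A (T / 2)
    (fun L hL => (hA L hL).1) (fun L hL => (hA L hL).2)
  set a := A / ((∫ z, Kf z) / 4) - K with ha
  have helim : Tendsto e atTop (nhds a) := by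
    refine (hlim.sub_const K).congr' ?_
    filter_upwards [eventually_ge_atTop X0] with x hx
    rw [hDge x hx]; ring
  refine ⟨a, ?_, helim⟩
  have hab := abelian e a hinte helim
  have tl : Tendsto (fun σ : ℝ => σ - 1) (nhdsWithin 1 (Ioi 1)) (nhdsWithin 0 (Ioi 0)) := by
    apply tendsto_nhdsWithin_of_tendsto_nhds_of_eventually_within
    · have : Tendsto (fun δ : ℝ => δ - 1) (nhds 1) (nhds (1 - 1)) := Continuous.tendsto (by fun_prop) 1
      rw [sub_self] at this
      exact this.mono_left nhdsWithin_le_nhds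
    · filter_upwards [self_mem_nhdsWithin] with δ hδ
      have : 1 < δ := hδ
      show 0 < δ - 1
      linarith
  refine (hab.comp tl).congr' ?_
  filter_upwards [self_mem_nhdsWithin] with σ hσ
  have hσ : 1 < σ := hσ
  have h1 := hUW (σ - 1) 0 (by linarith)
  simp only [Function.comp_apply]
  have h2 : (((1 + (σ - 1) : ℝ) : ℂ) + ((0:ℝ):ℂ) * Complex.I) = (σ : ℂ) := by simp
  rw [h2] at h1
  rw [h1]
  simp only [hW, zero_mul, Real.cos_zero, mul_one]
end

section
/- Let F(z) = Σ_{n=0}^∞ c_n z^n be analytic on the open unit disc 𝔻 with real coefficients c_n, and set U(z) = Re F(z). Assume U has L¹_loc-boundary behavior on ∂𝔻∖{1}. Assume further there exist θ₀ ∈ (0,π), g ∈ L¹(−θ₀,θ₀), a non-decreasing function η : [0,∞) → [1,∞) with ∫₁^∞ (log η(x))/x² dx < ∞, and C > 0 such that U(re^{iθ}) ≥ g(θ) for a.e. θ ∈ (−θ₀,θ₀) and all r ∈ [0,1), and |U(re^{iθ})| ≤ C·exp(η(1/(1−r))) for all θ ∈ (−θ₀,θ₀) and r ∈ [0,1). Then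 the sequence (c_n) converges, and its limit equals lim_{r→1⁻} (1−r) U(r). -/
open MeasureTheory Filter Set

/-- `U` (defined on the open unit disc) has `L¹_loc`-boundary behavior on
`∂𝔻 ∖ {1}` (boundary points parametrized as `e^{iθ}`, `θ ∈ [-π,π] ∖ {0}`). -/
def L1locBoundaryBehaviorDisc (U : ℂ → ℝ) : Prop :=
  ∃ f : ℝ → ℝ, ∀ a b : ℝ, -Real.pi ≤ a → a ≤ b → b ≤ Real.pi → (0 : ℝ) ∉ Icc a b →
    IntegrableOn f (Icc a b) ∧
    Tendsto (fun r : ℝ => ∫ θ in a..b, |U (r * Complex.exp (θ * Complex.I)) - f θ|)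
      (nhdsWithin 1 (Iio 1)) (nhds 0)

/-- Integral of `cos (m θ)` over a period, `m` a nonzero integer. -/
lemma aux_int_cos (m : ℤ) (hm : m ≠ 0) :
    ∫ θ in (-Real.pi)..Real.pi, Real.cos ((m : ℝ) * θ) = 0 := by
  have hm' : (m : ℝ) ≠ 0 := by exact_mod_cast hm
  rw [intervalIntegral.integral_comp_mul_left (fun x => Real.cos x) hm']
  simp [Real.sin_int_mul_pi]

lemma aux_int_cos_cos (k n : ℕ) (hn : 1 ≤ n) :
    ∫ θ in (-Real.pi)..Real.pi, Real.cos ((k : ℝ) * θ) * Real.cos ((n : ℝ) * θ)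
      = if k = n then Real.pi else 0 := by
  have h1 : ∀ θ : ℝ, Real.cos ((k : ℝ) * θ) * Real.cos ((n : ℝ) * θ)
      = (1 / 2) * (Real.cos ((((k : ℤ) + n : ℤ) : ℝ) * θ)
        + Real.cos ((((k : ℤ) - n : ℤ) : ℝ) * θ)) := by
    intro θ
    push_cast
    rw [add_mul, sub_mul, Real.cos_add, Real.cos_sub]
    ring
  simp_rw [h1]
  rw [intervalIntegral.integral_const_mul, intervalIntegral.integral_add
    (Continuous.intervalIntegrable (by fun_prop) _ _)
    (Continuous.intervalIntegrable (by fun_prop) _ _), aux_int_cos _ (by omega)]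
  split_ifs with h
  · subst h
    simp
    ring
  · rw [aux_int_cos _ (by omega)]
    simp

lemma aux_hasSum (c : ℕ → ℝ) (F : ℂ → ℂ)
    (hF : ∀ z : ℂ, ‖z‖ < 1 → HasSum (fun n : ℕ => (c n : ℂ) * z ^ n) (F z))
    (r : ℝ) (hr : r ∈ Ico (0 : ℝ) 1) (θ : ℝ) :
    HasSum (fun n : ℕ => c n * r ^ n * Real.cos (n * θ))
      (F (r * Complex.exp (θ * Complex.I))).re := by
  have hz : ‖(r : ℂ) * Complex.exp (θ * Complex.I)‖ < 1 := by
    rw [norm_mul, Complex.norm_exp_ofReal_mul_I, Complex.norm_real, Real.norm_eq_abs,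
      abs_of_nonneg hr.1, mul_one]
    exact hr.2
  have h := Complex.hasSum_re (hF _ hz)
  convert h using 2 with n
  rw [mul_pow, ← Complex.exp_nat_mul]
  have : (n : ℂ) * (θ * Complex.I) = ((n * θ : ℝ) : ℂ) * Complex.I := by push_cast; ring
  rw [this, ← mul_assoc]
  have h2 : (c n : ℂ) * (r : ℂ) ^ n = ((c n * r ^ n : ℝ) : ℂ) := by push_cast; rfl
  rw [h2, Complex.re_ofReal_mul, Complex.exp_ofReal_mul_I_re]

lemma aux_summable (c : ℕ → ℝ) (F : ℂ → ℂ)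
    (hF : ∀ z : ℂ, ‖z‖ < 1 → HasSum (fun n : ℕ => (c n : ℂ) * z ^ n) (F z))
    (r : ℝ) (hr : r ∈ Ico (0 : ℝ) 1) :
    Summable (fun n : ℕ => |c n * r ^ n|) := by
  have h := (aux_hasSum c F hF r hr 0).summable
  simpa using h.abs

lemma aux_cont (c : ℕ → ℝ) (F : ℂ → ℂ)
    (hF : ∀ z : ℂ, ‖z‖ < 1 → HasSum (fun n : ℕ => (c n : ℂ) * z ^ n) (F z))
    (r : ℝ) (hr : r ∈ Ico (0 : ℝ) 1) :
    Continuous (fun θ : ℝ => (F (r * Complex.exp (θ * Complex.I))).re) := by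
  have : (fun θ : ℝ => (F (r * Complex.exp (θ * Complex.I))).re)
      = fun θ : ℝ => ∑' n : ℕ, c n * r ^ n * Real.cos (n * θ) := by
    funext θ
    exact (aux_hasSum c F hF r hr θ).tsum_eq.symm
  rw [this]
  refine continuous_tsum (fun n => by fun_prop) (aux_summable c F hF r hr) ?_
  intro n θ
  rw [Real.norm_eq_abs, abs_mul]
  exact mul_le_of_le_one_right (abs_nonneg _) (Real.abs_cos_le_one _)

lemma aux_fourier (c : ℕ → ℝ) (F : ℂ → ℂ)
    (hF : ∀ z : ℂ, ‖z‖ < 1 → HasSum (fun n : ℕ => (c n : ℂ) * z ^ n) (F z))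
    (r : ℝ) (hr : r ∈ Ico (0 : ℝ) 1) (n : ℕ) :
    HasSum (fun k : ℕ => c k * r ^ k *
        ∫ θ in (-Real.pi)..Real.pi, Real.cos ((k : ℝ) * θ) * Real.cos ((n : ℝ) * θ))
      (∫ θ in (-Real.pi)..Real.pi,
        (F (r * Complex.exp (θ * Complex.I))).re * Real.cos (n * θ)) := by
  simp_rw [← intervalIntegral.integral_const_mul]
  refine intervalIntegral.hasSum_integral_of_dominated_convergence
    (fun k _ => |c k * r ^ k|) (fun k => ?_) (fun k => ?_) ?_ ?_ ?_
  · exact Continuous.aestronglyMeasurable (by fun_prop)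
  · refine ae_of_all _ fun θ _ => ?_
    rw [Real.norm_eq_abs, abs_mul, abs_mul (Real.cos _)]
    exact mul_le_of_le_one_right (abs_nonneg _)
      (mul_le_one₀ (Real.abs_cos_le_one _) (abs_nonneg _) (Real.abs_cos_le_one _))
  · exact ae_of_all _ fun θ _ => aux_summable c F hF r hr
  · exact intervalIntegrable_const
  · refine ae_of_all _ fun θ _ => ?_
    have := (aux_hasSum c F hF r hr θ).mul_right (Real.cos (n * θ))
    simpa [mul_assoc] using this

lemma aux_fourier_pos (c : ℕ → ℝ) (F : ℂ → ℂ)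
    (hF : ∀ z : ℂ, ‖z‖ < 1 → HasSum (fun n : ℕ => (c n : ℂ) * z ^ n) (F z))
    (r : ℝ) (hr : r ∈ Ico (0 : ℝ) 1) (n : ℕ) (hn : 1 ≤ n) :
    ∫ θ in (-Real.pi)..Real.pi,
        (F (r * Complex.exp (θ * Complex.I))).re * Real.cos (n * θ)
      = Real.pi * (c n * r ^ n) := by
  have h := aux_fourier c F hF r hr n
  simp_rw [aux_int_cos_cos _ n hn] at h
  have h2 := hasSum_single (f := fun k : ℕ => c k * r ^ k * if k = n then Real.pi else 0) n
    (fun k hk => by simp [hk])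
  rw [h.unique h2]
  simp [mul_comm]

lemma aux_fourier_zero (c : ℕ → ℝ) (F : ℂ → ℂ)
    (hF : ∀ z : ℂ, ‖z‖ < 1 → HasSum (fun n : ℕ => (c n : ℂ) * z ^ n) (F z))
    (r : ℝ) (hr : r ∈ Ico (0 : ℝ) 1) :
    ∫ θ in (-Real.pi)..Real.pi,
        (F (r * Complex.exp (θ * Complex.I))).re
      = 2 * Real.pi * c 0 := by
  have h := aux_fourier c F hF r hr 0
  have h2 := hasSum_single (f := fun k : ℕ => c k * r ^ k *
        ∫ θ in (-Real.pi)..Real.pi, Real.cos ((k : ℝ) * θ) * Real.cos (((0 : ℕ) : ℝ) * θ)) 0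
    (fun k hk => by
      have := aux_int_cos k (by exact_mod_cast hk)
      simp at this ⊢
      simp [this])
  have h3 := h.unique h2
  simp at h3
  rw [h3]
  ring

/-- Riemann-Lebesgue for cosines. -/
lemma aux_RL (f : ℝ → ℝ) (hf : IntervalIntegrable f volume (-Real.pi) Real.pi) :
    Tendsto (fun n : ℕ => ∫ θ in (-Real.pi)..Real.pi, f θ * Real.cos (n * θ)) atTop (nhds 0) := by
  have h0 := Real.tendsto_integral_exp_smul_cocompact
    ((Ioc (-Real.pi) Real.pi).indicator (fun θ => (f θ : ℂ)))
  have hn : Tendsto (fun n : ℕ => (n : ℝ) / (2 * Real.pi)) atTop (cocompact ℝ) :=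
    (tendsto_natCast_atTop_atTop.atTop_div_const (by positivity)).mono_right atTop_le_cocompact
  · have h1 := (Complex.continuous_re.tendsto _).comp (h0.comp hn)
    simp only [Complex.zero_re] at h1
    refine h1.congr fun n => ?_
    simp only [Function.comp]
    rw [intervalIntegral.integral_of_le (by linarith [Real.pi_pos]),
      ← integral_indicator measurableSet_Ioc]
    have hi : Integrable ((Ioc (-Real.pi) Real.pi).indicator (fun θ => (f θ : ℂ))) := by
      rw [integrable_indicator_iff measurableSet_Ioc]
      exact ((intervalIntegrable_iff_integrableOn_Ioc_of_le
        (by linarith [Real.pi_pos])).1 hf).ofReal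
    have hi2 : Integrable (fun v : ℝ => Real.fourierChar (-(v * ((n : ℝ) / (2 * Real.pi)))) •
        (Ioc (-Real.pi) Real.pi).indicator (fun θ => (f θ : ℂ)) v) := by
      have := (Real.fourierIntegral_convergent_iff (μ := volume) (f := ((Ioc (-Real.pi) Real.pi).indicator (fun θ => (f θ : ℂ)))) ((n : ℝ) / (2 * Real.pi))).2 hi
      simpa [mul_comm] using this
    rw [← RCLike.re_eq_complex_re, ← integral_re hi2]
    congr 1
    funext v
    by_cases hv : v ∈ Ioc (-Real.pi) Real.pi
    · simp only [indicator_of_mem hv]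
      rw [Circle.smul_def, Real.fourierChar_apply]
      have : 2 * Real.pi * -(v * ((n : ℝ) / (2 * Real.pi))) = -(n * v) := by
        field_simp
      rw [this, smul_eq_mul, RCLike.re_eq_complex_re, mul_comm, Complex.re_ofReal_mul,
        Complex.exp_ofReal_mul_I_re, Real.cos_neg]
    · simp [indicator_of_notMem hv]

/-- Abel means. -/
lemma aux_abel (c : ℕ → ℝ) (a : ℝ) (hc : Tendsto c atTop (nhds a)) (V : ℝ → ℝ)
    (hV : ∀ r ∈ Ico (0 : ℝ) 1, HasSum (fun n => c n * r ^ n) (V r)) :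
    Tendsto (fun r : ℝ => (1 - r) * V r) (nhdsWithin 1 (Iio 1)) (nhds a) := by
  let d : ℕ → ℝ := fun n => c n - if n = 0 then 0 else c (n - 1)
  have hd : ∀ n, ∑ i ∈ Finset.range (n + 1), d i = c n := by
    intro n
    induction n with
    | zero => simp [d]
    | succ k ih => rw [Finset.sum_range_succ, ih]; simp [d]
  have h1 : Tendsto (fun n => ∑ i ∈ Finset.range n, d i) atTop (nhds a) := by
    rw [← tendsto_add_atTop_iff_nat 1]
    simpa [hd] using hc
  refine (Real.tendsto_tsum_powerSeries_nhdsWithin_lt h1).congr' ?_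
  filter_upwards [Ioo_mem_nhdsLT (show (0 : ℝ) < 1 by norm_num)] with r hr
  have h2 := hV r ⟨hr.1.le, hr.2⟩
  have h3 : HasSum (fun n => (if n = 0 then 0 else c (n - 1)) * r ^ n) (r * V r) := by
    rw [← hasSum_nat_add_iff' 1]
    simp
    convert! h2.mul_left r using 2 with n
    ring
  have h4 := h2.sub h3
  have h5 : (fun n => d n * r ^ n)
      = fun n => c n * r ^ n - (if n = 0 then 0 else c (n - 1)) * r ^ n := by
    funext n
    simp only [d]
    ring
  rw [h5, h4.tsum_eq]
  ring

/-- The `L¹`-boundary hypothesis for a family of functions `u r`. -/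
def AuxL1 (u : ℝ → ℝ → ℝ) (f : ℝ → ℝ) : Prop :=
  ∀ a b : ℝ, -Real.pi ≤ a → a ≤ b → b ≤ Real.pi → (0 : ℝ) ∉ Icc a b →
    IntegrableOn f (Icc a b) ∧
    Tendsto (fun r : ℝ => ∫ θ in a..b, |u r θ - f θ|) (nhdsWithin 1 (Iio 1)) (nhds 0)

lemma aux_ev : ∀ᶠ r : ℝ in nhdsWithin 1 (Iio 1), r ∈ Ico (0 : ℝ) 1 := by
  filter_upwards [Ioo_mem_nhdsLT (show (0 : ℝ) < 1 by norm_num)] with r hr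
  exact ⟨hr.1.le, hr.2⟩

lemma aux_ii {f : ℝ → ℝ} {a b : ℝ} (hab : a ≤ b) (h : IntegrableOn f (Icc a b)) :
    IntervalIntegrable f volume a b :=
  (intervalIntegrable_iff_integrableOn_Icc_of_le hab).2 h

/-- comparison of `L¹` norms on an interval -/
lemma aux_tri {v w : ℝ → ℝ} {a b : ℝ} (hab : a ≤ b) (hv : IntervalIntegrable v volume a b)
    (hw : IntervalIntegrable w volume a b) :
    ∫ θ in a..b, |v θ| ≤ (∫ θ in a..b, |w θ|) + ∫ θ in a..b, |v θ - w θ| := by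
  rw [← intervalIntegral.integral_add hw.abs (hv.sub hw).abs]
  refine intervalIntegral.integral_mono_on hab hv.abs (hw.abs.add (hv.sub hw).abs) ?_
  intro θ _
  have := abs_add_le (w θ) (v θ - w θ)
  simpa using this

lemma aux_bound (u : ℝ → ℝ → ℝ) (f : ℝ → ℝ) (hu : ∀ r ∈ Ico (0 : ℝ) 1, Continuous (u r))
    (hf : AuxL1 u f) (K : ℝ)
    (hK : ∀ r ∈ Ico (0 : ℝ) 1, ∫ θ in (-Real.pi)..Real.pi, u r θ = K)
    (θ₀ : ℝ) (hθ₀ : θ₀ ∈ Ioo 0 Real.pi)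
    (g : ℝ → ℝ) (hg : IntegrableOn g (Ioo (-θ₀) θ₀))
    (hlow : ∀ r ∈ Ico (0 : ℝ) 1, ∀ᵐ θ ∂(volume.restrict (Ioo (-θ₀) θ₀)), g θ ≤ u r θ) :
    ∃ M : ℝ, ∀ᶠ r in nhdsWithin 1 (Iio 1), ∫ θ in (-Real.pi)..Real.pi, |u r θ| ≤ M := by
  obtain ⟨h0, hpi⟩ := hθ₀
  obtain ⟨i1, t1⟩ := hf θ₀ Real.pi (by linarith) hpi.le le_rfl (fun h => by linarith [h.1])
  obtain ⟨i2, t2⟩ := hf (-Real.pi) (-θ₀) le_rfl (by linarith) (by linarith)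
    (fun h => by linarith [h.2])
  replace i1 := aux_ii hpi.le i1
  replace i2 := aux_ii (by linarith) i2
  have hgi : IntervalIntegrable g volume (-θ₀) θ₀ :=
    (intervalIntegrable_iff_integrableOn_Ioo_of_le (by linarith)).2 hg
  refine ⟨K + 2 * (((∫ θ in θ₀..Real.pi, |f θ|) + 1)
    + ((∫ θ in (-Real.pi)..(-θ₀), |f θ|) + 1)) + 2 * ∫ θ in (-θ₀)..θ₀, |g θ|, ?_⟩
  filter_upwards [aux_ev, t1.eventually (gt_mem_nhds zero_lt_one),
    t2.eventually (gt_mem_nhds zero_lt_one)] with r hr e1 e2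
  have hc := hu r hr
  have ci : ∀ a b, IntervalIntegrable (u r) volume a b := fun a b => hc.intervalIntegrable a b
  have b1 := aux_tri hpi.le (ci _ _) i1
  have b2 := aux_tri (by linarith) (ci _ _) i2
  have b3 : ∫ θ in (-θ₀)..θ₀, |u r θ| ≤
      (∫ θ in (-θ₀)..θ₀, u r θ) + 2 * ∫ θ in (-θ₀)..θ₀, |g θ| := by
    rw [← intervalIntegral.integral_const_mul,
      ← intervalIntegral.integral_add (ci _ _) (hgi.abs.const_mul 2)]
    refine intervalIntegral.integral_mono_ae_restrict (by linarith) (ci _ _).abs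
      ((ci _ _).add (hgi.abs.const_mul 2)) ?_
    rw [← Measure.restrict_congr_set Ioo_ae_eq_Icc]
    filter_upwards [hlow r hr] with θ hθ
    show |u r θ| ≤ u r θ + 2 * |g θ|
    rcases abs_cases (u r θ) with h | h <;> rcases abs_cases (g θ) with h' | h' <;> linarith
  have s1 : ∀ w : ℝ → ℝ, (∀ a b, IntervalIntegrable w volume a b) →
      ∫ θ in (-Real.pi)..Real.pi, w θ = (∫ θ in (-Real.pi)..(-θ₀), w θ)
        + (∫ θ in (-θ₀)..θ₀, w θ) + ∫ θ in θ₀..Real.pi, w θ := by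
    intro w hw
    rw [intervalIntegral.integral_add_adjacent_intervals (hw _ _) (hw _ _),
      intervalIntegral.integral_add_adjacent_intervals (hw _ _) (hw _ _)]
  have s2 := s1 _ ci
  have s3 := s1 _ (fun a b => (ci a b).abs)
  rw [hK r hr] at s2
  have n1 := intervalIntegral.abs_integral_le_integral_abs (f := u r) (μ := volume) hpi.le
  have n2 := intervalIntegral.abs_integral_le_integral_abs (f := u r) (μ := volume)
    (show -Real.pi ≤ -θ₀ by linarith)
  have n3 := neg_abs_le (∫ θ in θ₀..Real.pi, u r θ)
  have n4 := neg_abs_le (∫ θ in (-Real.pi)..(-θ₀), u r θ)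
  rw [s3]
  linarith

lemma aux_integrable (u : ℝ → ℝ → ℝ) (f : ℝ → ℝ)
    (hu : ∀ r ∈ Ico (0 : ℝ) 1, Continuous (u r)) (hf : AuxL1 u f) (M : ℝ)
    (hM : ∀ᶠ r in nhdsWithin 1 (Iio 1), ∫ θ in (-Real.pi)..Real.pi, |u r θ| ≤ M) :
    IntervalIntegrable f volume (-Real.pi) Real.pi := by
  have hpi := Real.pi_pos
  have key : ∀ a b : ℝ, -Real.pi ≤ a → a ≤ b → b ≤ Real.pi → (0 : ℝ) ∉ Icc a b →
      IntegrableOn f (Ioc a b) ∧ ∫ θ in Ioc a b, ‖f θ‖ ≤ M + 1 := by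
    intro a b ha hab hb h0
    obtain ⟨i1, t1⟩ := hf a b ha hab hb h0
    refine ⟨i1.mono_set Ioc_subset_Icc_self, ?_⟩
    obtain ⟨r, hr, e1, e2⟩ := (aux_ev.and ((t1.eventually (gt_mem_nhds zero_lt_one)).and hM)).exists
    have ci : ∀ a b, IntervalIntegrable (u r) volume a b :=
      fun a b => (hu r hr).intervalIntegrable a b
    have b1 := aux_tri hab (aux_ii hab i1) (ci a b)
    have b2 : ∫ θ in a..b, |u r θ| ≤ ∫ θ in (-Real.pi)..Real.pi, |u r θ| :=
      intervalIntegral.integral_mono_interval ha hab hb (ae_of_all _ fun θ => abs_nonneg _)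
        (ci _ _).abs
    simp_rw [abs_sub_comm (f _)] at b1
    rw [intervalIntegral.integral_of_le hab] at b1
    simp only [Real.norm_eq_abs]
    linarith
  have hs : ∀ n : ℕ, 0 < Real.pi / ((n : ℝ) + 1) ∧ Real.pi / ((n : ℝ) + 1) ≤ Real.pi := by
    intro n
    refine ⟨by positivity, div_le_self hpi.le ?_⟩
    have : (0 : ℝ) ≤ n := n.cast_nonneg
    linarith
  have ht : Tendsto (fun n : ℕ => Real.pi / ((n : ℝ) + 1)) atTop (nhds 0) :=
    tendsto_const_nhds.div_atTop (tendsto_atTop_add_const_right _ _ tendsto_natCast_atTop_atTop)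
  have k1 : ∀ n : ℕ, _ := fun n => key (Real.pi / ((n : ℝ) + 1)) Real.pi
    (by linarith [(hs n).1]) (hs n).2 le_rfl (fun h => by linarith [h.1, (hs n).1])
  have k2 : ∀ n : ℕ, _ := fun n => key (-Real.pi) (-(Real.pi / ((n : ℝ) + 1))) le_rfl
    (by linarith [(hs n).2]) (by linarith [(hs n).1]) (fun h => by linarith [h.2, (hs n).1])
  have I1 : IntegrableOn f (Ioc 0 Real.pi) :=
    integrableOn_Ioc_of_intervalIntegral_norm_bounded_left (fun n => (k1 n).1) ht
      (Eventually.of_forall fun n => (k1 n).2)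
  have I2 : IntegrableOn f (Ioc (-Real.pi) 0) :=
    integrableOn_Ioc_of_intervalIntegral_norm_bounded_right (fun n => (k2 n).1)
      (by simpa using ht.neg) (Eventually.of_forall fun n => (k2 n).2)
  exact ((intervalIntegrable_iff_integrableOn_Ioc_of_le (by linarith)).2 I2).trans
    ((intervalIntegrable_iff_integrableOn_Ioc_of_le hpi.le).2 I1)

lemma aux_conv (u : ℝ → ℝ → ℝ) (f : ℝ → ℝ)
    (hu : ∀ r ∈ Ico (0 : ℝ) 1, Continuous (u r)) (hf : AuxL1 u f) (M : ℝ)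
    (hM : ∀ᶠ r in nhdsWithin 1 (Iio 1), ∫ θ in (-Real.pi)..Real.pi, |u r θ| ≤ M)
    (φ : ℝ → ℝ) (hφ : Continuous φ) (hφ0 : φ 0 = 0) (hφ2 : ∀ θ, |φ θ| ≤ 2) :
    Tendsto (fun r => ∫ θ in (-Real.pi)..Real.pi, u r θ * φ θ) (nhdsWithin 1 (Iio 1))
      (nhds (∫ θ in (-Real.pi)..Real.pi, f θ * φ θ)) := by
  have hpi := Real.pi_pos
  have hfi := aux_integrable u f hu hf M hM
  set N := ∫ θ in (-Real.pi)..Real.pi, |f θ| with hN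
  have hN0 : 0 ≤ N := intervalIntegral.integral_nonneg (by linarith) fun _ _ => abs_nonneg _
  have hM0 : 0 ≤ M := by
    obtain ⟨r, hr⟩ := hM.exists
    exact le_trans (intervalIntegral.integral_nonneg (by linarith) fun _ _ => abs_nonneg _) hr
  rw [Metric.tendsto_nhds]
  intro ε hε
  set e := ε / (2 * (M + N + 1)) with he
  have hepos : 0 < e := by positivity
  obtain ⟨δ', hδ', hδ2'⟩ := Metric.continuous_iff.1 hφ 0 e hepos
  obtain ⟨δ, hδ, hδ1, hδ2⟩ : ∃ δ : ℝ, 0 < δ ∧ δ < δ' ∧ δ < Real.pi :=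
    ⟨min δ' Real.pi / 2, by positivity,
      by linarith [min_le_left δ' Real.pi, lt_min hδ' hpi],
      by linarith [min_le_right δ' Real.pi, lt_min hδ' hpi]⟩
  obtain ⟨-, t1⟩ := hf δ Real.pi (by linarith) hδ2.le le_rfl (fun h => by linarith [h.1])
  obtain ⟨-, t2⟩ := hf (-Real.pi) (-δ) le_rfl (by linarith) (by linarith)
    (fun h => by linarith [h.2])
  filter_upwards [aux_ev, t1.eventually (gt_mem_nhds (show 0 < ε / 8 by positivity)),
    t2.eventually (gt_mem_nhds (show 0 < ε / 8 by positivity)), hM] with r hr e1 e2 e3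
  have ci : ∀ a b, IntervalIntegrable (u r) volume a b :=
    fun a b => (hu r hr).intervalIntegrable a b
  have hh : IntervalIntegrable (fun θ => u r θ - f θ) volume (-Real.pi) Real.pi := (ci _ _).sub hfi
  have hsub : ∀ a b, -Real.pi ≤ a → a ≤ b → b ≤ Real.pi →
      IntervalIntegrable (fun θ => u r θ - f θ) volume a b := by
    intro a b ha hab hb
    refine hh.mono_set ?_
    rw [uIcc_of_le hab, uIcc_of_le (by linarith)]
    exact Icc_subset_Icc ha hb
  have hprod : ∀ a b, -Real.pi ≤ a → a ≤ b → b ≤ Real.pi →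
      IntervalIntegrable (fun θ => |(u r θ - f θ) * φ θ|) volume a b := by
    intro a b ha hab hb
    exact ((hsub a b ha hab hb).mul_continuousOn hφ.continuousOn).abs
  have piece : ∀ a b B, -Real.pi ≤ a → a ≤ b → b ≤ Real.pi → (∀ θ ∈ Icc a b, |φ θ| ≤ B) →
      ∫ θ in a..b, |(u r θ - f θ) * φ θ| ≤ B * ∫ θ in a..b, |u r θ - f θ| := by
    intro a b B ha hab hb hB
    rw [← intervalIntegral.integral_const_mul]
    refine intervalIntegral.integral_mono_on hab (hprod a b ha hab hb)
      ((hsub a b ha hab hb).abs.const_mul B) ?_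
    intro θ hθ
    rw [abs_mul, mul_comm]
    exact mul_le_mul_of_nonneg_right (hB θ hθ) (abs_nonneg _)
  have p1 := piece δ Real.pi 2 (by linarith) hδ2.le le_rfl (fun θ _ => hφ2 θ)
  have p2 := piece (-Real.pi) (-δ) 2 le_rfl (by linarith) (by linarith) (fun θ _ => hφ2 θ)
  have p3 := piece (-δ) δ e (by linarith) (by linarith) hδ2.le (fun θ hθ => by
    have h := hδ2' θ (by rw [Real.dist_eq, sub_zero]; exact lt_of_le_of_lt (abs_le.2 hθ) hδ1)
    rw [Real.dist_eq, hφ0, sub_zero] at h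
    exact h.le)
  have q : ∫ θ in (-δ)..δ, |u r θ - f θ| ≤ M + N := by
    calc ∫ θ in (-δ)..δ, |u r θ - f θ| ≤ ∫ θ in (-Real.pi)..Real.pi, |u r θ - f θ| :=
          intervalIntegral.integral_mono_interval (by linarith) (by linarith) hδ2.le
            (ae_of_all _ fun θ => abs_nonneg _) hh.abs
      _ ≤ ∫ θ in (-Real.pi)..Real.pi, (|u r θ| + |f θ|) :=
          intervalIntegral.integral_mono_on (by linarith) hh.abs ((ci _ _).abs.add hfi.abs)
            (fun θ _ => abs_sub _ _)
      _ = (∫ θ in (-Real.pi)..Real.pi, |u r θ|) + N :=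
          intervalIntegral.integral_add (ci _ _).abs hfi.abs
      _ ≤ M + N := by linarith
  have q2 : e * ∫ θ in (-δ)..δ, |u r θ - f θ| < ε / 2 := by
    calc e * ∫ θ in (-δ)..δ, |u r θ - f θ| ≤ e * (M + N) :=
          mul_le_mul_of_nonneg_left q hepos.le
      _ < e * (M + N + 1) := mul_lt_mul_of_pos_left (by linarith) hepos
      _ = ε / 2 := by rw [he]; field_simp
  rw [Real.dist_eq, ← intervalIntegral.integral_sub
    ((ci _ _).mul_continuousOn hφ.continuousOn) (hfi.mul_continuousOn hφ.continuousOn)]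
  simp_rw [← sub_mul]
  refine lt_of_le_of_lt
    (intervalIntegral.abs_integral_le_integral_abs (by linarith)) ?_
  rw [← intervalIntegral.integral_add_adjacent_intervals (b := δ)
      (hprod _ _ le_rfl (by linarith) hδ2.le) (hprod _ _ (by linarith) hδ2.le le_rfl),
    ← intervalIntegral.integral_add_adjacent_intervals (b := -δ)
      (hprod _ _ le_rfl (by linarith) (by linarith))
      (hprod _ _ (by linarith) (by linarith) hδ2.le)]
  linarith

/-- Remark 6.3 (power series version): Tauberian theorem for power series where
the polynomial growth bound in (b.3) is relaxed to
`|U(re^{iθ})| ≤ C·exp(η(1/(1-r)))` with `η : [0,∞) → [1,∞)` non-decreasing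
satisfying `∫₁^∞ log η(x)/x² dx < ∞`. -/
theorem power_series_tauberian_ultra (c : ℕ → ℝ) (F : ℂ → ℂ)
    (hF : ∀ z : ℂ, ‖z‖ < 1 → HasSum (fun n : ℕ => (c n : ℂ) * z ^ n) (F z))
    (U : ℂ → ℝ) (hU : ∀ z : ℂ, U z = (F z).re)
    (hbd : L1locBoundaryBehaviorDisc U)
    (θ₀ : ℝ) (hθ₀ : θ₀ ∈ Ioo 0 Real.pi)
    (g : ℝ → ℝ) (hg : IntegrableOn g (Ioo (-θ₀) θ₀))
    (η : ℝ → ℝ) (hη_mono : MonotoneOn η (Ici 0))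
    (hη_ge : ∀ x ∈ Ici (0 : ℝ), 1 ≤ η x)
    (hη_int : IntegrableOn (fun x : ℝ => Real.log (η x) / x ^ 2) (Ioi 1))
    (C : ℝ) (hC : 0 < C)
    (hlow : ∀ r ∈ Ico (0 : ℝ) 1, ∀ᵐ θ ∂(volume.restrict (Ioo (-θ₀) θ₀)),
      g θ ≤ U (r * Complex.exp (θ * Complex.I)))
    (hgrow : ∀ θ ∈ Ioo (-θ₀) θ₀, ∀ r ∈ Ico (0 : ℝ) 1,
      |U (r * Complex.exp (θ * Complex.I))| ≤ C * Real.exp (η (1 / (1 - r)))) :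
    ∃ a : ℝ,
      Tendsto c atTop (nhds a) ∧
      Tendsto (fun r : ℝ => (1 - r) * U r) (nhdsWithin 1 (Iio 1)) (nhds a) := by
  obtain ⟨f, hf⟩ := hbd
  let u : ℝ → ℝ → ℝ := fun r θ => U (r * Complex.exp (θ * Complex.I))
  have hue : ∀ r θ, u r θ = (F (r * Complex.exp (θ * Complex.I))).re := fun r θ => hU _
  have hu : ∀ r ∈ Ico (0 : ℝ) 1, Continuous (u r) := by
    intro r hr
    have h := aux_cont c F hF r hr
    exact h.congr fun θ => (hue r θ).symm
  have hfu : AuxL1 u f := hf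
  have hK : ∀ r ∈ Ico (0 : ℝ) 1, ∫ θ in (-Real.pi)..Real.pi, u r θ = 2 * Real.pi * c 0 := by
    intro r hr
    simp_rw [hue]
    exact aux_fourier_zero c F hF r hr
  obtain ⟨M, hM⟩ := aux_bound u f hu hfu _ hK θ₀ hθ₀ g hg hlow
  have hfi := aux_integrable u f hu hfu M hM
  set A := 2 * Real.pi * c 0 - ∫ θ in (-Real.pi)..Real.pi, f θ with hA
  have hcn : ∀ n : ℕ, 1 ≤ n →
      c n = (A + ∫ θ in (-Real.pi)..Real.pi, f θ * Real.cos (n * θ)) / Real.pi := by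
    intro n hn
    have hφ : Continuous (fun θ : ℝ => Real.cos (n * θ) - 1) := by fun_prop
    have t1 := aux_conv u f hu hfu M hM (fun θ : ℝ => Real.cos (n * θ) - 1) hφ (by simp)
      (fun θ => by
        rw [abs_le]
        constructor <;> linarith [Real.neg_one_le_cos (n * θ), Real.cos_le_one (n * θ)])
    have t2 : Tendsto (fun r : ℝ => Real.pi * (c n * r ^ n) - 2 * Real.pi * c 0)
        (nhdsWithin 1 (Iio 1)) (nhds (Real.pi * (c n * 1 ^ n) - 2 * Real.pi * c 0)) := by
      refine Tendsto.mono_left (Continuous.tendsto ?_ 1) nhdsWithin_le_nhds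
      fun_prop
    have t3 : Tendsto (fun r : ℝ => Real.pi * (c n * r ^ n) - 2 * Real.pi * c 0)
        (nhdsWithin 1 (Iio 1))
        (nhds (∫ θ in (-Real.pi)..Real.pi, f θ * (Real.cos (n * θ) - 1))) := by
      refine t1.congr' ?_
      filter_upwards [aux_ev] with r hr
      rw [← hK r hr, ← aux_fourier_pos c F hF r hr n hn]
      simp_rw [← hue, mul_sub, mul_one]
      have hc1 : Continuous (fun θ : ℝ => Real.cos (n * θ)) := by fun_prop
      exact intervalIntegral.integral_sub (((hu r hr).mul hc1).intervalIntegrable _ _)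
        ((hu r hr).intervalIntegrable _ _)
    have h := tendsto_nhds_unique t2 t3
    simp_rw [mul_sub, mul_one] at h
    have hc1 : Continuous (fun θ : ℝ => Real.cos (n * θ)) := by fun_prop
    rw [intervalIntegral.integral_sub (hfi.mul_continuousOn hc1.continuousOn) hfi] at h
    rw [eq_div_iff Real.pi_pos.ne', hA]
    simp only [one_pow, mul_one] at h
    linarith
  have hlim : Tendsto c atTop (nhds (A / Real.pi)) := by
    have h1 := ((aux_RL f hfi).const_add A).div_const Real.pi
    rw [add_zero] at h1
    refine h1.congr' ?_
    filter_upwards [eventually_ge_atTop 1] with n hn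
    exact (hcn n hn).symm
  refine ⟨A / Real.pi, hlim, aux_abel c _ hlim (fun r => U r) ?_⟩
  intro r hr
  have h := aux_hasSum c F hF r hr 0
  simpa [hU] using h
end
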